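/- Let 𝔤 be a finite-dimensional semisimple Lie algebra over the field ℂ of complex numbers satisfying the condition 𝒜(n), i.e. every abelian Lie subalgebra of 𝔤 has dimension at most n. Then dim 𝔤 ≤ 7n. -/

import Mathlib

/-- The orbit of the simple roots `x i` under the simple reflections `v ↦ v - P i v • x i`. -/
inductive RootOrbit {ι M : Type*} [AddCommGroup M] (x : ι → M) (P : ι → M →+ ℤ) : M → Prop
  | simple (i : ι) : RootOrbit x P (x i)
  | reflect (i : ι) {v : M} (hv : RootOrbit x P v) : RootOrbit x P (v - P i v • x i)

/-- `A` is realised as the Cartan matrix of simple roots `x i` and simple coroots `P i` in a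
lattice, the roots lie in a finite set `R`, and there is a set `S` of roots, no two of which sum to
zero or to a root, with `#R + rank ≤ 7 * #S`. -/
def HasLargeCommutingSet {ι : Type*} [Fintype ι] (A : ι → ι → ℤ) : Prop :=
  ∃ (M : Type) (_ : AddCommGroup M) (x : ι → M) (P : ι → M →+ ℤ) (R S : Finset M),
    (∀ i j, P i (x j) = A j i) ∧ (∀ v, RootOrbit x P v → v ∈ R) ∧ (∀ v ∈ S, RootOrbit x P v) ∧
    (∀ u ∈ S, ∀ v ∈ S, ¬ RootOrbit x P (u + v) ∧ u + v ≠ 0) ∧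
    R.card + Fintype.card ι ≤ 7 * S.card

namespace RootOrbit

variable {ι M : Type*} [AddCommGroup M] {x : ι → M} {P : ι → M →+ ℤ}

lemma neg (h : ∀ i, P i (x i) = 2) {v : M} (hv : RootOrbit x P v) : RootOrbit x P (-v) := by
  induction hv with
  | simple i =>
    have := RootOrbit.reflect i (RootOrbit.simple (x := x) (P := P) i)
    rw [h] at this
    convert this using 1
    rw [two_smul]
    abel
  | reflect i hv ih =>
    convert RootOrbit.reflect i ih using 1
    rw [map_neg, neg_smul]
    abel

end RootOrbit

namespace RootPairing.Base

variable {ι K V N : Type*} [Field K] [CharZero K] [AddCommGroup V] [Module K V]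
  [AddCommGroup N] [Module K N] {Q : RootPairing ι K V N} (b : Q.Base)

lemma pairingIn_eq_sum [Q.IsCrystallographic] {k : ι} {c : b.support → ℤ}
    (hc : Q.root k = ∑ j, c j • Q.root j)
    (i : ι) : Q.pairingIn ℤ k i = ∑ j : b.support, c j * Q.pairingIn ℤ j i := by
  apply FaithfulSMul.algebraMap_injective ℤ K
  simp only [map_sum, map_mul, algebraMap_pairingIn]
  simp_rw [← Q.root_coroot'_eq_pairing]
  simp [hc]

lemma eq_of_sum_root_eq {c d : b.support → ℤ}
    (h : ∑ j : b.support, c j • Q.root j = ∑ j : b.support, d j • Q.root j) : c = d :=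
  funext <| Fintype.linearIndependent_iffₛ.mp
    (b.linearIndepOn_root.restrict_scalars' ℤ) c d (by simpa using h)

lemma exists_large_commuting_set [Fintype ι] [Q.IsRootSystem] [Q.IsCrystallographic]
    [Q.IsReduced] (hA : HasLargeCommutingSet b.cartanMatrix) :
    ∃ S : Finset ι, (∀ i ∈ S, ∀ j ∈ S, Q.root i + Q.root j ∉ Set.range Q.root ∧
      Q.root i + Q.root j ≠ 0) ∧ Fintype.card ι + b.support.card ≤ 7 * S.card := by
  classical
  obtain ⟨M, _, x, P, R, S, hP, hR, hS, hSS, hcard⟩ := hA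
  have hP2 (i) : P i (x i) = 2 := by rw [hP]; exact b.cartanMatrix_apply_same i
  have hPf (i : b.support) (c : b.support → ℤ) :
      P i (∑ j, c j • x j) = ∑ j, c j * Q.pairingIn ℤ j i := by
    simp [map_sum, hP, RootPairing.Base.cartanMatrixIn]
  have refl {k : ι} {c : b.support → ℤ} (hc : Q.root k = ∑ j, c j • Q.root j) (i : b.support) :
      Q.root (Q.reflectionPerm i k) =
        ∑ j, (c - P i (∑ j, c j • x j) • (Pi.single i 1 : b.support → ℤ)) j • Q.root j ∧
      ∑ j, (c - P i (∑ j, c j • x j) • (Pi.single i 1 : b.support → ℤ)) j • x j =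
        (∑ j, c j • x j) - P i (∑ j, c j • x j) • x i := by
    constructor
    · rw [root_reflectionPerm, reflection_apply_root, hPf, ← pairingIn_eq_sum b hc]
      rw [← algebraMap_pairingIn Q ℤ]
      simp [-Finset.univ_eq_attach, sub_smul, Finset.sum_sub_distrib, ← hc, Int.cast_smul_eq_zsmul,
        Pi.single_apply, ite_smul]
    · simp [-Finset.univ_eq_attach, sub_smul, Finset.sum_sub_distrib, Pi.single_apply, ite_smul]
  have h1 (k : ι) : ∃ c : b.support → ℤ, Q.root k = ∑ j, c j • Q.root j ∧
      RootOrbit x P (∑ j, c j • x j) := by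
    induction k using b.induction_reflect with
    | h₀ k ih =>
      obtain ⟨c, hc, hc'⟩ := ih
      refine ⟨-c, ?_, ?_⟩
      · simp [-Finset.univ_eq_attach, ← hc]
      · simpa using hc'.neg hP2
    | h₁ k hk =>
      refine ⟨Pi.single ⟨k, hk⟩ 1, ?_, ?_⟩
      · simp [Pi.single_apply, ite_smul]
      · simpa [Pi.single_apply, ite_smul] using RootOrbit.simple (x := x) (P := P) ⟨k, hk⟩
    | h₂ k i ih hi =>
      obtain ⟨c, hc, hc'⟩ := ih
      obtain ⟨e1, e2⟩ := refl hc ⟨i, hi⟩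
      exact ⟨_, e1, e2 ▸ hc'.reflect _⟩
  choose c hc hcO using h1
  set F : ι → M := fun k ↦ ∑ j, c k j • x j with hF
  have hsurj {v : M} (hv : RootOrbit x P v) : ∃ k, F k = v := by
    induction hv with
    | simple i =>
      refine ⟨i, ?_⟩
      have : c i = Pi.single i 1 := by
        apply eq_of_sum_root_eq b
        simp [-Finset.univ_eq_attach, ← hc, Pi.single_apply, ite_smul]
      simp [hF, this, Pi.single_apply, ite_smul]
    | reflect i hv ih =>
      obtain ⟨k, rfl⟩ := ih
      obtain ⟨e1, e2⟩ := refl (hc k) i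
      refine ⟨Q.reflectionPerm i k, ?_⟩
      rw [← e2]
      rw [hF]
      congr! 2 with j
      exact congr_fun (eq_of_sum_root_eq b ((hc _).symm.trans e1)) j
  have hinj : Function.Injective F := by
    intro k l hkl
    apply b.injective_pairingIn
    funext i
    simp only
    rw [pairingIn_eq_sum b (hc k), pairingIn_eq_sum b (hc l), ← hPf, ← hPf]
    exact congr_arg _ hkl
  have hadd {i j k : ι} (h : Q.root i + Q.root j = Q.root k) : F i + F j = F k := by
    have : c k = c i + c j := by
      apply eq_of_sum_root_eq b
      rw [← hc, ← h]
      simp [-Finset.univ_eq_attach, add_smul, Finset.sum_add_distrib, ← hc]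
    simp [hF, this, add_smul, Finset.sum_add_distrib]
  have hzero {i j : ι} (h : Q.root i + Q.root j = 0) : F i + F j = 0 := by
    have : c i + c j = 0 := by
      apply eq_of_sum_root_eq b
      simpa [-Finset.univ_eq_attach, add_smul, Finset.sum_add_distrib, ← hc] using h
    have h2 : F i + F j = ∑ l, (c i + c j) l • x l := by
      simp [hF, add_smul, Finset.sum_add_distrib]
    rw [h2, this]; simp
  have hS' : (S.preimage F hinj.injOn).card = S.card := by
    rw [Finset.card_preimage]
    congr 1
    rw [Finset.filter_eq_self]
    exact fun v hv ↦ hsurj (hS v hv)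
  refine ⟨S.preimage F hinj.injOn, fun i hi j hj ↦ ?_, ?_⟩
  · rw [Finset.mem_preimage] at hi hj
    obtain ⟨h1, h2⟩ := hSS _ hi _ hj
    refine ⟨?_, fun h ↦ h2 (hzero h)⟩
    rintro ⟨k, hk⟩
    rw [hadd hk.symm] at h1
    exact h1 (hcO k)
  · rw [hS']
    have : Fintype.card ι ≤ R.card := by
      rw [← Finset.card_univ, ← Finset.card_image_of_injective _ hinj]
      refine Finset.card_le_card fun v hv ↦ ?_
      obtain ⟨k, -, rfl⟩ := Finset.mem_image.mp hv
      exact hR _ (hcO k)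
    rw [Fintype.card_coe] at hcard
    omega

end RootPairing.Base

lemma Submodule.finrank_sup_le_sum {K V κ : Type*} [Field K] [AddCommGroup V] [Module K V]
    [FiniteDimensional K V] (s : Finset κ) (f : κ → Submodule K V) :
    Module.finrank K (s.sup f : Submodule K V) ≤ ∑ i ∈ s, Module.finrank K (f i) := by
  classical
  induction s using Finset.induction_on with
  | empty => simp
  | insert a s ha ih =>
    rw [Finset.sup_insert, Finset.sum_insert ha]
    exact (Submodule.finrank_add_le_finrank_add_finrank _ _).trans (by lia)

namespace LieAlgebra.IsKilling

variable {K L : Type*} [Field K] [CharZero K] [IsAlgClosed K] [LieRing L] [LieAlgebra K L]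
  [FiniteDimensional K L] [IsKilling K L] (H : LieSubalgebra K L) [H.IsCartanSubalgebra]

lemma finrank_le_card_root_add_finrank :
    Module.finrank K L ≤ H.root.card + Module.finrank K H := by
  classical
  let f : LieModule.Weight K H L → Submodule K L := fun χ ↦ (rootSpace H χ).toSubmodule
  have htop : H.toSubmodule ⊔ H.root.sup f = ⊤ := by
    rw [eq_top_iff, ← LieSubmodule.top_toSubmodule (R := K) (L := H),
      ← LieModule.iSup_genWeightSpace_eq_top' K H L, LieSubmodule.iSup_toSubmodule, iSup_le_iff]
    intro χ
    by_cases hχ : χ.IsZero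
    · refine le_sup_of_le_left (le_of_eq ?_)
      have : (χ : H → K) = 0 := hχ
      rw [this]
      simp
    · exact le_sup_of_le_right (Finset.le_sup (f := f) (by simpa using hχ))
  rw [← finrank_top (R := K) (M := L), ← htop]
  refine (Submodule.finrank_add_le_finrank_add_finrank _ _).trans ?_
  have := Submodule.finrank_sup_le_sum H.root f
  rw [Finset.sum_congr rfl (g := fun _ ↦ 1), Finset.sum_const, smul_eq_mul, mul_one] at this
  · exact (add_comm _ _).trans_le (Nat.add_le_add_right this _)
  · intro α hα
    exact finrank_rootSpace_eq_one α (by simpa using hα)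

lemma exists_commuting_submodule (b : (rootSystem H).Base)
    (hA : HasLargeCommutingSet b.cartanMatrix) :
    ∃ W : Submodule K L, (∀ x ∈ W, ∀ y ∈ W, ⁅x, y⁆ = 0) ∧
      Module.finrank K L ≤ 7 * Module.finrank K W := by
  classical
  obtain ⟨S, hS, hcard⟩ := b.exists_large_commuting_set hA
  have hne (α : H.root) : ∃ v ∈ rootSpace H α.1, v ≠ 0 :=
    α.1.exists_ne_zero
  choose v hv hv0 using hne
  have hli : LinearIndependent K v := by
    have h1 := LieModule.iSupIndep_genWeightSpace' K H L
    rw [← LieSubmodule.iSupIndep_toSubmodule] at h1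
    exact (h1.comp (Subtype.val_injective (p := (· ∈ H.root)))).linearIndependent _ hv hv0
  have hcomm (α) (hα : α ∈ S) (β) (hβ : β ∈ S) : ⁅v α, v β⁆ = 0 := by
    obtain ⟨h1, h2⟩ := hS α hα β hβ
    have hmem := lie_mem_genWeightSpace_of_mem_genWeightSpace (hv α) (hv β)
    by_contra h0
    have hbot : LieModule.genWeightSpace L ((α.1 : H → K) + (β.1 : H → K)) ≠ ⊥ :=
      fun h ↦ h0 (by simpa [h] using hmem)
    let γ : LieModule.Weight K H L := ⟨_, hbot⟩
    have hγ : (LieModule.Weight.toLinear K H L γ) =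
        (rootSystem H).root α + (rootSystem H).root β := by
      ext; simp [γ]
    by_cases hz : γ.IsZero
    · apply h2
      rw [← hγ]
      ext y
      simpa using congr_fun hz y
    · exact h1 ⟨⟨γ, by simpa using hz⟩, by rw [← hγ]; simp⟩
  refine ⟨Submodule.span K (v '' S), fun x hx y hy ↦ ?_, ?_⟩
  · induction hx using Submodule.span_induction with
    | zero => simp
    | add x x' _ _ h h' => simp [h, h']
    | smul a x _ h => simp [h]
    | mem x hx =>
      obtain ⟨α, hα, rfl⟩ := hx
      induction hy using Submodule.span_induction with
      | zero => simp
      | add x x' _ _ h h' => simp [h, h']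
      | smul a x _ h => simp [h]
      | mem y hy =>
        obtain ⟨β, hβ, rfl⟩ := hy
        exact hcomm α hα β hβ
  · have h1 : Module.finrank K (Submodule.span K (v '' S)) = S.card := by
      have := finrank_span_eq_card (hli.comp ((↑) : S → H.root) Subtype.val_injective)
      rw [Fintype.card_coe] at this
      rwa [Set.range_comp, Subtype.range_coe_subtype, Finset.setOfPred_mem] at this
    have h2 := finrank_le_card_root_add_finrank H
    have h3 : b.support.card = Module.finrank K H := by
      rw [← Subspace.dual_finrank_eq, Module.finrank_eq_card_basis b.toWeightBasis]
      simp
    rw [Fintype.card_coe] at hcard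
    lia

end LieAlgebra.IsKilling

lemma HasLargeCommutingSet.of_equiv {ι κ : Type*} [Fintype ι] [Fintype κ] {A : ι → ι → ℤ}
    (e : κ ≃ ι) (h : HasLargeCommutingSet fun i j ↦ A (e i) (e j)) : HasLargeCommutingSet A := by
  obtain ⟨M, _, x, P, R, S, hP, hR, hS, hSS, hcard⟩ := h
  have horb (v : M) : RootOrbit (x ∘ e.symm) (P ∘ e.symm) v ↔ RootOrbit x P v := by
    constructor
    · intro hv
      induction hv with
      | simple i => exact .simple _
      | reflect i hv ih => exact .reflect _ ih
    · intro hv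
      induction hv with
      | simple i => simpa using RootOrbit.simple (x := x ∘ e.symm) (P := P ∘ e.symm) (e i)
      | reflect i hv ih => simpa using RootOrbit.reflect (e i) ih
  refine ⟨M, _, x ∘ e.symm, P ∘ e.symm, R, S, fun i j ↦ ?_, ?_, ?_, ?_, ?_⟩
  · simp [hP]
  · simpa only [horb]
  · simpa only [horb]
  · simpa only [horb]
  · rwa [← Fintype.card_congr e]

/-- The Cartan integers of the Dynkin diagram of type `A`, with nodes numbered along the path. -/
def pathCartan (i j : ℕ) : ℤ := if i = j then 2 else if i + 1 = j ∨ j + 1 = i then -1 else 0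

/-- The Cartan matrix of a path with one more node attached at the node `q`. -/
def extCartan (k q : ℕ) (a b : ℤ) : Option (Fin k) → Option (Fin k) → ℤ
  | none, none => 2
  | none, some i => if (i : ℕ) = q then -a else 0
  | some i, none => if (i : ℕ) = q then -b else 0
  | some i, some j => pathCartan i j

namespace LatticeModel

open Finset

/-- The lattice containing all our models of root systems. -/
abbrev Lat (n : ℕ) : Type := (Fin n → ℤ) × ℤ

/-- The indicator vector of a finite set of coordinates. -/
def ind {n : ℕ} (T : Finset (Fin n)) : Fin n → ℤ := fun i ↦ if i ∈ T then 1 else 0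

/-- The linear form giving a coordinate of a vector. -/
def coord {n : ℕ} (i : Fin n) : Lat n →+ ℤ := (Pi.evalAddMonoidHom _ i).comp (AddMonoidHom.fst _ _)

/-- The sum of the coordinates. -/
def lin {n : ℕ} (m : Fin n → ℤ) : ℤ := ∑ i, m i

/-- The sum of the squares of the coordinates. -/
def quad {n : ℕ} (m : Fin n → ℤ) : ℤ := ∑ i, m i ^ 2

/-- The difference of two basis vectors. -/
def diff {n : ℕ} (i j : Fin n) : Fin n → ℤ := Pi.single i 1 - Pi.single j 1

variable {n k : ℕ}

@[simp] lemma coord_apply (i : Fin n) (v : Lat n) : coord i v = v.1 i := rfl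

lemma ind_injective : Function.Injective (ind (n := n)) := by
  intro S T h
  ext i
  have := congr_fun h i
  simp only [ind] at this
  split_ifs at this <;> simp_all

lemma lin_ind (T : Finset (Fin n)) : lin (ind T) = T.card := by simp [lin, ind]

lemma lin_add (u v : Fin n → ℤ) : lin (u + v) = lin u + lin v := by simp [lin, sum_add_distrib]

lemma lin_sub (u v : Fin n → ℤ) : lin (u - v) = lin u - lin v := by simp [lin]

lemma lin_neg (u : Fin n → ℤ) : lin (-u) = -lin u := by simp [lin]

lemma lin_smul (c : ℤ) (u : Fin n → ℤ) : lin (c • u) = c * lin u := by simp [lin, mul_sum]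

lemma lin_single (i : Fin n) (a : ℤ) : lin (Pi.single i a) = a := by simp [lin]

lemma lin_comp (m : Fin n → ℤ) (σ : Equiv.Perm (Fin n)) : lin (m ∘ σ) = lin m :=
  Equiv.sum_comp σ m

lemma quad_comp (m : Fin n → ℤ) (σ : Equiv.Perm (Fin n)) : quad (m ∘ σ) = quad m :=
  Equiv.sum_comp σ fun i ↦ m i ^ 2

lemma quad_sub_smul (m z : Fin n → ℤ) (c : ℤ) :
    quad (m - c • z) = quad m - 2 * c * ∑ i, m i * z i + c ^ 2 * quad z := by
  simp only [quad, mul_sum, ← sum_sub_distrib, ← sum_add_distrib, Pi.sub_apply, Pi.smul_apply]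
  exact sum_congr rfl fun i _ ↦ by rw [smul_eq_mul]; ring

lemma quad_smul (m : Fin n → ℤ) (c : ℤ) : quad (c • m) = c ^ 2 * quad m := by
  simp [quad, mul_sum, mul_pow]

lemma quad_single (i : Fin n) (a : ℤ) : quad (Pi.single i a) = a ^ 2 := by
  rw [quad, sum_eq_single i] <;> simp +contextual

lemma quad_nonneg (m : Fin n → ℤ) : 0 ≤ quad m := sum_nonneg fun _ _ ↦ sq_nonneg _

lemma eq_zero_of_quad {m : Fin n → ℤ} (h : quad m = 0) : m = 0 := by
  funext i
  rw [quad, sum_eq_zero_iff_of_nonneg fun _ _ ↦ sq_nonneg _] at h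
  simpa using h i (mem_univ i)

lemma quad_sub_single (m : Fin n → ℤ) (i : Fin n) :
    quad (m - Pi.single i (m i)) = quad m - m i ^ 2 := by
  have := quad_sub_smul m (Pi.single i (m i)) 1
  rw [one_smul, quad_single, sum_eq_single i] at this
  · rw [this, Pi.single_eq_same]; ring
  · intro j _ hj; simp [hj]
  · simp

lemma exists_ne_zero_of_quad {m : Fin n → ℤ} (h : quad m ≠ 0) : ∃ i, m i ≠ 0 := by
  by_contra! h0
  exact h (by simp [quad, h0])

lemma exists_single_of_quad_eq_one {m : Fin n → ℤ} (h : quad m = 1) :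
    ∃ i, m = Pi.single i 1 ∨ m = -Pi.single i 1 := by
  obtain ⟨i, hi⟩ := exists_ne_zero_of_quad (m := m) (by lia)
  have h1 := quad_sub_single m i
  have h2 := quad_nonneg (m - Pi.single i (m i))
  have h3 : 0 < m i ^ 2 := by positivity
  have h4 : m i ^ 2 = 1 := by lia
  have h5 := sub_eq_zero.mp (eq_zero_of_quad (h1.trans (by lia)))
  refine ⟨i, ?_⟩
  rcases sq_eq_sq_iff_eq_or_eq_neg.mp (h4.trans (one_pow 2).symm) with h | h
  · left; rwa [h] at h5
  · right; rwa [h, Pi.single_neg] at h5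

lemma ind_pair {i j : Fin n} (h : i ≠ j) :
    ind {i, j} = Pi.single i 1 + Pi.single j 1 := by
  funext l
  simp only [ind, mem_insert, mem_singleton, Pi.add_apply, Pi.single_apply]
  split_ifs <;> simp_all

lemma exists_of_quad_eq_two {m : Fin n → ℤ} (h : quad m = 2) :
    ∃ i j, i ≠ j ∧ (m = diff i j ∨ m = ind {i, j} ∨ m = -ind {i, j}) := by
  obtain ⟨i, hi⟩ := exists_ne_zero_of_quad (m := m) (by lia)
  have h1 := quad_sub_single m i
  have h2 := quad_nonneg (m - Pi.single i (m i))
  have h3 : m i = 1 ∨ m i = -1 := by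
    have : m i < 2 := by nlinarith
    have : -2 < m i := by nlinarith
    lia
  have h4 : m i ^ 2 = 1 := by rcases h3 with h | h <;> simp [h]
  obtain ⟨j, hj⟩ := exists_single_of_quad_eq_one (h1.trans (by lia))
  have hij : i ≠ j := by
    rintro rfl
    rcases hj with hj | hj <;> simpa using congr_fun hj i
  rcases h3 with h3 | h3 <;> rw [h3] at hj <;> rcases hj with hj | hj
  · refine ⟨i, j, hij, .inr (.inl ?_)⟩
    rw [ind_pair hij, ← hj]; abel
  · refine ⟨i, j, hij, .inl ?_⟩
    rw [diff, sub_eq_add_neg, ← hj]; abel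
  · refine ⟨j, i, hij.symm, .inl ?_⟩
    rw [Pi.single_neg, sub_neg_eq_add] at hj
    rw [diff, ← hj]; abel
  · refine ⟨i, j, hij, .inr (.inr ?_)⟩
    rw [ind_pair hij, neg_add, ← hj, Pi.single_neg]; abel

/-- The differences of distinct basis vectors. -/
def diffs (n : ℕ) : Finset (Lat n) :=
  (univ.offDiag : Finset (Fin n × Fin n)).image fun p ↦ (diff p.1 p.2, 0)

lemma mem_diffs {i j : Fin n} (h : i ≠ j) : ((diff i j, 0) : Lat n) ∈ diffs n :=
  mem_image.mpr ⟨(i, j), by simpa using h, rfl⟩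

lemma card_diffs_le : (diffs n).card ≤ n * n - n := by
  refine card_image_le.trans ?_
  simp [offDiag_card]

/-- The indicator vectors of sets of size `r`. -/
def inds (n r : ℕ) (t : ℤ) : Finset (Lat n) := (powersetCard r univ).image fun T ↦ (ind T, t)

lemma mem_inds {T : Finset (Fin n)} {r : ℕ} {t : ℤ} (h : T.card = r) :
    ((ind T, t) : Lat n) ∈ inds n r t :=
  mem_image.mpr ⟨T, mem_powersetCard.mpr ⟨subset_univ _, h⟩, rfl⟩

lemma card_inds {r : ℕ} {t : ℤ} : (inds n r t).card = n.choose r := by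
  rw [inds, card_image_of_injective, card_powersetCard, card_fin]
  intro S T h
  exact ind_injective (Prod.mk.inj h).1

/-- The simple roots of type `A`. -/
def pathRoot (i : Fin k) : Lat (k + 1) := (diff i.castSucc i.succ, 0)

/-- The simple coroots of type `A`. -/
def pathCoroot (i : Fin k) : Lat (k + 1) →+ ℤ := coord i.castSucc - coord i.succ

lemma sub_pathRoot (v : Lat (k + 1)) (i : Fin k) :
    v - pathCoroot i v • pathRoot i = (v.1 ∘ Equiv.swap i.castSucc i.succ, v.2) := by
  refine Prod.ext ?_ (by simp [pathRoot])
  funext j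
  have hne : i.castSucc ≠ i.succ := Fin.castSucc_lt_succ.ne
  simp only [pathRoot, pathCoroot, diff, Prod.fst_sub, Prod.smul_fst, Pi.sub_apply, Pi.smul_apply,
    AddMonoidHom.sub_apply, coord_apply, Function.comp_apply, smul_eq_mul, Pi.single_apply,
    Equiv.swap_apply_def]
  split_ifs <;> simp_all

lemma pathCoroot_pathRoot (i j : Fin k) : pathCoroot i (pathRoot j) = pathCartan j i := by
  simp only [pathRoot, pathCoroot, diff, Pi.sub_apply, Pi.single_apply, AddMonoidHom.sub_apply,
    coord_apply, pathCartan, Fin.ext_iff, Fin.val_castSucc, Fin.val_succ]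
  split_ifs <;> lia

/-- A system of simple roots extending that of type `A`. -/
structure ExtendsPath {κ : Type*} (x : κ → Lat (k + 1)) (P : κ → Lat (k + 1) →+ ℤ) : Prop where
  exists_node (i : Fin k) : ∃ c, x c = pathRoot i ∧ P c = pathCoroot i

namespace ExtendsPath

variable {κ : Type*} {x : κ → Lat (k + 1)} {P : κ → Lat (k + 1) →+ ℤ}

lemma comp (h : ExtendsPath x P) (σ : Equiv.Perm (Fin (k + 1))) {m : Fin (k + 1) → ℤ} {t : ℤ}
    (hv : RootOrbit x P (m, t)) : RootOrbit x P (m ∘ σ, t) := by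
  have hσ : σ ∈ Submonoid.closure
      (Set.range fun i : Fin k ↦ Equiv.swap i.castSucc i.succ) := by
    rw [Equiv.Perm.mclosure_swap_castSucc_succ]; trivial
  induction hσ using Submonoid.closure_induction generalizing m with
  | mem σ hσ =>
    obtain ⟨i, rfl⟩ := hσ
    obtain ⟨c, hc, hc'⟩ := h.exists_node i
    have := hv.reflect c
    rwa [hc, hc', sub_pathRoot] at this
  | one => exact hv
  | mul σ τ _ _ h1 h2 => exact h2 (h1 hv)

lemma ind (h : ExtendsPath x P) {S T : Finset (Fin (k + 1))} {t : ℤ} (hST : S.card = T.card)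
    (hv : RootOrbit x P (ind S, t)) : RootOrbit x P (LatticeModel.ind T, t) := by
  obtain ⟨σ, rfl⟩ := Equiv.Perm.exists_map_finset_eq T S hST.symm
  convert h.comp σ hv using 2
  funext j
  simp [LatticeModel.ind]

lemma single (h : ExtendsPath x P) {i j : Fin (k + 1)} {a t : ℤ}
    (hv : RootOrbit x P (Pi.single i a, t)) : RootOrbit x P (Pi.single j a, t) := by
  convert h.comp (Equiv.swap i j) hv using 2
  funext l
  simp only [Pi.single_apply, Function.comp_apply, Equiv.swap_apply_def]
  split_ifs <;> simp_all

lemma diff (h : ExtendsPath x P) (hk : 0 < k) {i j : Fin (k + 1)} (hij : i ≠ j) :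
    RootOrbit x P (diff i j, 0) := by
  obtain ⟨c, hc, -⟩ := h.exists_node ⟨0, hk⟩
  have h0 := RootOrbit.simple (x := x) (P := P) c
  rw [hc, pathRoot] at h0
  obtain ⟨σ, hσ⟩ := Equiv.Perm.exists_extending_pair ![i, j]
    ![Fin.castSucc ⟨0, hk⟩, Fin.succ ⟨0, hk⟩]
    (by intro a b; fin_cases a <;> fin_cases b <;> simp [hij, hij.symm])
    (by intro a b; fin_cases a <;> fin_cases b <;> simp [Fin.ext_iff])
  convert h.comp σ h0 using 2
  funext l
  have h1 : σ i = Fin.castSucc ⟨0, hk⟩ := hσ 0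
  have h2 : σ j = Fin.succ ⟨0, hk⟩ := hσ 1
  simp only [LatticeModel.diff, ← h1, ← h2, Pi.sub_apply, Function.comp_apply, Pi.single_apply,
    EmbeddingLike.apply_eq_iff_eq]

end ExtendsPath

lemma lin_diff (i j : Fin n) : lin (diff i j) = 0 := by simp [diff, lin_sub, lin_single]

lemma quad_diff {i j : Fin n} (h : i ≠ j) : quad (diff i j) = 2 := by
  have := quad_sub_smul (Pi.single i 1) (Pi.single j 1) 1
  rw [one_smul, quad_single, quad_single, sum_eq_single i] at this
  · simpa [diff, h] using this
  · intro l _ hl; simp [hl]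
  · simp

lemma diff_inj {i j i' j' : Fin n} (h : i ≠ j) (he : diff i j = diff i' j') : i = i' ∧ j = j' := by
  have h1 := congr_fun he i
  have h2 := congr_fun he j
  simp only [diff, Pi.sub_apply, Pi.single_apply] at h1 h2
  constructor
  · by_contra h'
    simp only [if_true, if_neg h, if_neg h'] at h1
    split_ifs at h1 <;> simp at h1
  · by_contra h'
    simp only [if_true, if_neg h.symm, if_neg h'] at h2
    split_ifs at h2 <;> simp at h2

lemma quad_ind (T : Finset (Fin n)) : quad (ind T) = T.card := by simp [quad, ind]

lemma diff_mem_of_quad {m : Fin n → ℤ} (h : quad m = 2) (h' : lin m = 0) :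
    ((m, 0) : Lat n) ∈ diffs n := by
  obtain ⟨i, j, hij, rfl | rfl | rfl⟩ := exists_of_quad_eq_two h
  · exact mem_diffs hij
  · simp [lin_ind, hij] at h'
  · simp [lin_neg, lin_ind, hij] at h'

theorem hasLargeCommutingSet_path (k : ℕ) :
    HasLargeCommutingSet fun i j : Fin k ↦ pathCartan i j := by
  set h := (k + 1) / 2 with hh
  have hx : ExtendsPath (pathRoot (k := k)) pathCoroot := ⟨fun i ↦ ⟨i, rfl, rfl⟩⟩
  have hR (v : Lat (k + 1)) (hv : RootOrbit pathRoot pathCoroot v) : v ∈ diffs (k + 1) := by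
    suffices quad v.1 = 2 ∧ lin v.1 = 0 ∧ v.2 = 0 by
      obtain ⟨m, t⟩ := v
      obtain ⟨h1, h2, rfl⟩ := this
      exact diff_mem_of_quad h1 h2
    induction hv with
    | simple i => exact ⟨quad_diff Fin.castSucc_lt_succ.ne, lin_diff _ _, rfl⟩
    | reflect i hv ih => rw [sub_pathRoot]; simpa [quad_comp, lin_comp] using ih
  let f : Lat (k + 1) →+ ℤ := ∑ i with i.val < h, coord i
  have hf (i j : Fin (k + 1)) :
      f (diff i j, 0) = (if i.val < h then 1 else 0) - if j.val < h then 1 else 0 := by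
    simp [f, diff, sum_sub_distrib, Pi.single_apply]
  let S : Finset (Lat (k + 1)) :=
    ((univ.filter fun i : Fin (k + 1) ↦ i.val < h) ×ˢ
      (univ.filter fun i : Fin (k + 1) ↦ i.val < h)ᶜ).image fun p ↦ (diff p.1 p.2, 0)
  have hS {v} (hv : v ∈ S) : ∃ i j : Fin (k + 1), i.val < h ∧ h ≤ j.val ∧ v = (diff i j, 0) := by
    obtain ⟨⟨i, j⟩, hij, rfl⟩ := mem_image.mp hv
    exact ⟨i, j, by simpa using hij⟩
  have hfS {v} (hv : v ∈ S) : f v = 1 := by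
    obtain ⟨i, j, hi, hj, rfl⟩ := hS hv
    simp [hf, hi, hj]
  refine ⟨_, _, pathRoot, pathCoroot, diffs (k + 1), S, pathCoroot_pathRoot, hR, ?_, ?_, ?_⟩
  · intro v hv
    obtain ⟨i, j, hi, hj, rfl⟩ := hS hv
    exact hx.diff (by lia) (Fin.ne_of_lt (by lia))
  · intro u hu v hv
    have huv : f (u + v) = 2 := by rw [map_add, hfS hu, hfS hv]; rfl
    refine ⟨fun h0 ↦ ?_, fun h0 ↦ by simp [h0] at huv⟩
    obtain ⟨⟨i, j⟩, -, hij⟩ := mem_image.mp (hR _ h0)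
    rw [← hij, hf] at huv
    split_ifs at huv <;> simp at huv
  · have hcard : S.card = h * (k + 1 - h) := by
      rw [card_image_of_injOn, card_product, card_compl, Fin.card_filter_val_lt, Fintype.card_fin,
        min_eq_right (by lia)]
      rintro ⟨i, j⟩ hij ⟨i', j'⟩ - he
      have hne : i ≠ j := Fin.ne_of_lt (by simp at hij; lia)
      obtain ⟨rfl, rfl⟩ := diff_inj hne (Prod.mk.inj he).1
      rfl
    have := card_diffs_le (n := k + 1)
    rw [hcard, Fintype.card_fin]
    have h2 : (k + 1) * (k + 1) - (k + 1) + k ≤ 7 * (h * (k + 1 - h)) := by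
      rcases Nat.even_or_odd' (k + 1) with ⟨r, hr | hr⟩
      · have : h = r := by lia
        rw [this, hr, show 2 * r - r = r by lia]
        have : k = 2 * r - 1 := by lia
        subst this
        have : 2 * r ≤ 2 * r * (2 * r) := Nat.le_mul_self _
        zify [this, show 1 ≤ 2 * r by lia]
        nlinarith
      · have : h = r := by lia
        rw [this, hr, show 2 * r + 1 - r = r + 1 by lia]
        have : k = 2 * r := by lia
        subst this
        have : 2 * r + 1 ≤ (2 * r + 1) * (2 * r + 1) := Nat.le_mul_self _
        zify [this]
        nlinarith
    lia

/-- Simple roots extending those of type `A` by `z`. -/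
def extRoot (z : Lat (k + 1)) : Option (Fin k) → Lat (k + 1) := fun o ↦ o.elim z pathRoot

/-- Simple coroots extending those of type `A` by `φ`. -/
def extCoroot (φ : Lat (k + 1) →+ ℤ) : Option (Fin k) → Lat (k + 1) →+ ℤ :=
  fun o ↦ o.elim φ pathCoroot

variable {z : Lat (k + 1)} {φ : Lat (k + 1) →+ ℤ}

lemma extendsPath_ext : ExtendsPath (extRoot z) (extCoroot φ) := ⟨fun i ↦ ⟨some i, rfl, rfl⟩⟩

lemma RootOrbit.new : RootOrbit (extRoot z) (extCoroot φ) z :=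
  RootOrbit.simple (x := extRoot z) none

lemma RootOrbit.reflect_new {v w : Lat (k + 1)} (hv : RootOrbit (extRoot z) (extCoroot φ) v)
    (hw : v - φ v • z = w) : RootOrbit (extRoot z) (extCoroot φ) w :=
  hw ▸ hv.reflect none

lemma extCoroot_extRoot {q : ℕ} {a b : ℤ} (hz : φ z = 2)
    (h1 : ∀ i : Fin k, φ (pathRoot i) = if (i : ℕ) = q then -b else 0)
    (h2 : ∀ i : Fin k, pathCoroot i z = if (i : ℕ) = q then -a else 0) (i j : Option (Fin k)) :
    extCoroot φ i (extRoot z j) = extCartan k q a b j i := by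
  cases i <;> cases j
  · exact hz
  · exact h1 _
  · exact h2 _
  · exact pathCoroot_pathRoot _ _

lemma RootOrbit.invariant {p : Lat (k + 1) → Prop}
    (hcomp : ∀ m t (σ : Equiv.Perm (Fin (k + 1))), p (m, t) → p (m ∘ σ, t))
    (hdiff : ∀ i j, i ≠ j → p (diff i j, 0)) (hz : p z) (hrefl : ∀ v, p v → p (v - φ v • z))
    {v : Lat (k + 1)} (hv : RootOrbit (extRoot z) (extCoroot φ) v) : p v := by
  induction hv with
  | simple i =>
    cases i
    · exact hz
    · exact hdiff _ _ Fin.castSucc_lt_succ.ne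
  | reflect i hv ih =>
    cases i
    · exact hrefl _ ih
    · rename_i v i
      change p (v - pathCoroot i v • pathRoot i)
      rw [sub_pathRoot]
      exact hcomp _ _ _ ih

/-- The vectors with two nonzero coordinates, both `1` or `-1`. -/
def pairs (n : ℕ) : Finset (Lat n) := diffs n ∪ inds n 2 0 ∪ (inds n 2 0).image Neg.neg

lemma mem_pairs {m : Fin n → ℤ} (h : quad m = 2) : ((m, 0) : Lat n) ∈ pairs n := by
  obtain ⟨i, j, hij, rfl | rfl | rfl⟩ := exists_of_quad_eq_two h
  · exact mem_union_left _ (mem_union_left _ (mem_diffs hij))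
  · exact mem_union_left _ (mem_union_right _ (mem_inds (card_pair hij)))
  · exact mem_union_right _ (mem_image.mpr ⟨_, mem_inds (t := 0) (card_pair hij), by simp⟩)

lemma card_pairs_le : (pairs n).card ≤ n * n - n + 2 * n.choose 2 := by
  have h1 := card_union_le (diffs n ∪ inds n 2 0) ((inds n 2 0).image Neg.neg)
  have h2 := card_union_le (diffs n) (inds n 2 0)
  have h3 : ((inds n 2 0).image Neg.neg).card ≤ _ := card_image_le
  have h4 := card_diffs_le (n := n)
  rw [card_inds] at h2 h3
  change (pairs n).card ≤ _ at h1
  lia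

lemma lin_le_of_quad_eq_two {m : Fin n → ℤ} (h : quad m = 2) : lin m ≤ 2 := by
  obtain ⟨i, j, hij, rfl | rfl | rfl⟩ := exists_of_quad_eq_two h <;>
    simp [lin_neg, lin_ind, lin_diff, hij]

lemma two_mul_choose_two (n : ℕ) : 2 * n.choose 2 = n * n - n := by
  rw [Nat.choose_two_right, Nat.mul_div_cancel' n.even_mul_pred_self.two_dvd, Nat.mul_sub_one]

lemma exists_of_mem_inds {r : ℕ} {t : ℤ} {v : Lat n} (h : v ∈ inds n r t) :
    ∃ T : Finset (Fin n), T.card = r ∧ v = (ind T, t) := by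
  obtain ⟨T, hT, rfl⟩ := mem_image.mp h
  exact ⟨T, (mem_powersetCard.mp hT).2, rfl⟩

theorem hasLargeCommutingSet_double_end (l : ℕ) {a b : ℤ} (h : a = 1 ∧ b = 2 ∨ a = 2 ∧ b = 1) :
    HasLargeCommutingSet (extCartan (l + 1) l a b) := by
  have hab : a * b = 2 := by rcases h with ⟨rfl, rfl⟩ | ⟨rfl, rfl⟩ <;> rfl
  have ha : a ≤ 2 := by lia
  have ha0 : 0 < a := by lia
  let z : Lat (l + 2) := (Pi.single (Fin.last _) a, 0)
  let φ : Lat (l + 2) →+ ℤ := b • coord (Fin.last _)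
  have hφ (v) : φ v = b * v.1 (Fin.last _) := rfl
  have hrefl (v : Lat (l + 2)) : v - φ v • z =
      (v.1 - (2 * v.1 (Fin.last _)) • Pi.single (Fin.last _) 1, v.2) := by
    refine Prod.ext ?_ (by simp [z])
    funext i
    simp only [hφ, z, Prod.fst_sub, Prod.smul_fst, Pi.sub_apply, Pi.smul_apply, smul_eq_mul,
      Pi.single_apply, ← hab]
    split_ifs <;> ring
  have hquad (m : Fin (l + 2) → ℤ) :
      quad (m - (2 * m (Fin.last _)) • Pi.single (Fin.last _) 1) = quad m := by
    rw [quad_sub_smul, quad_single, sum_eq_single (Fin.last _)]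
    · rw [Pi.single_eq_same]; ring
    · intro i _ hi; simp [hi]
    · simp
  let p (v : Lat (l + 2)) : Prop := v.2 = 0 ∧ (quad v.1 = 2 ∨ ∃ m, v.1 = a • m ∧ quad m = 1)
  have hp {v} (hv : RootOrbit (extRoot z) (extCoroot φ) v) : p v := by
    refine RootOrbit.invariant ?_ ?_ ?_ ?_ hv
    · rintro m t σ ⟨h1, h2 | ⟨m', rfl, h2⟩⟩
      · exact ⟨h1, .inl ((quad_comp _ _).trans h2)⟩
      · exact ⟨h1, .inr ⟨m' ∘ σ, rfl, (quad_comp _ _).trans h2⟩⟩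
    · exact fun i j hij ↦ ⟨rfl, .inl (quad_diff hij)⟩
    · refine ⟨rfl, .inr ⟨Pi.single (Fin.last _) 1, ?_, by simp [quad_single]⟩⟩
      simp [z, ← Pi.single_smul]
    · rintro ⟨m, t⟩ ⟨h1, h2⟩
      rw [hrefl]
      refine ⟨h1, h2.imp (fun h2 ↦ (hquad _).trans h2) ?_⟩
      rintro ⟨m', rfl : m = _, h3⟩
      refine ⟨_, ?_, (hquad m').trans h3⟩
      simp only [Pi.smul_apply, smul_eq_mul, smul_sub, smul_smul]
      congr 2
      ring
  have hlin {v} (hv : RootOrbit (extRoot z) (extCoroot φ) v) : lin v.1 ≤ 2 := by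
    obtain ⟨-, h1 | ⟨m, hm, h1⟩⟩ := hp hv
    · exact lin_le_of_quad_eq_two h1
    · obtain ⟨i, rfl | rfl⟩ := exists_single_of_quad_eq_one h1 <;>
        rw [hm, lin_smul] <;> simp [lin_neg, lin_single] <;> lia
  let Z : Finset (Lat (l + 2)) := univ.image fun i ↦ (Pi.single i a, 0)
  have hZ : Z.card ≤ l + 2 := card_image_le.trans (by simp)
  let S : Finset (Lat (l + 2)) := insert (Pi.single 0 a, 0) (inds (l + 2) 2 0)
  have hS {v} (hv : v ∈ S) : v = (Pi.single 0 a, 0) ∨ ∃ T : Finset (Fin (l + 2)), T.card = 2 ∧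
      v = (ind T, 0) := (mem_insert.mp hv).imp_right exists_of_mem_inds
  have hlinS {v} (hv : v ∈ S) : v = (Pi.single 0 a, 0) ∨ lin v.1 = 2 := by
    refine (hS hv).imp_right ?_
    rintro ⟨T, hT, rfl⟩
    simp [lin_ind, hT]
  refine ⟨_, _, extRoot z, extCoroot φ, pairs (l + 2) ∪ Z ∪ Z.image Neg.neg, S,
    extCoroot_extRoot ?_ ?_ ?_, ?_, ?_, ?_, ?_⟩
  · simp [hφ, z, mul_comm b, hab]
  · intro i
    simp only [hφ, pathRoot, diff, Pi.sub_apply, Pi.single_apply, Fin.ext_iff, Fin.val_last,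
      Fin.val_castSucc, Fin.val_succ]
    split_ifs <;> lia
  · intro i
    simp only [pathCoroot, z, AddMonoidHom.sub_apply, coord_apply, Pi.single_apply, Fin.ext_iff,
      Fin.val_last, Fin.val_castSucc, Fin.val_succ]
    split_ifs <;> lia
  · rintro ⟨m, t⟩ hv
    obtain ⟨rfl : t = 0, h1 | ⟨m, rfl : _ = _, h1⟩⟩ := hp hv
    · exact mem_union_left _ (mem_union_left _ (mem_pairs h1))
    · obtain ⟨i, rfl | rfl⟩ := exists_single_of_quad_eq_one h1
      · refine mem_union_left _ (mem_union_right _ (mem_image.mpr ⟨i, mem_univ _, ?_⟩))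
        simp [← Pi.single_smul]
      · refine mem_union_right _ (mem_image.mpr ⟨(Pi.single i a, 0), ?_, ?_⟩)
        · exact mem_image.mpr ⟨i, mem_univ _, rfl⟩
        · simp [← Pi.single_smul]
  · intro v hv
    obtain rfl | ⟨T, hT, rfl⟩ := hS hv
    · exact extendsPath_ext.single RootOrbit.new
    · refine extendsPath_ext.ind (S := {0, Fin.last _}) ?_ (RootOrbit.reflect_new
        (extendsPath_ext.diff (i := 0) (j := Fin.last _) (by lia) ?_) ?_)
      · rw [hT, card_pair]; exact (Fin.last_pos).ne
      · exact (Fin.last_pos).ne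
      · have h0 : (0 : Fin (l + 2)) ≠ Fin.last _ := (Fin.last_pos).ne
        rw [hrefl, ind_pair h0]
        refine Prod.ext ?_ rfl
        funext i
        simp [diff, Pi.single_apply]
        split_ifs <;> simp
  · intro u hu v hv
    suffices lin (u + v).1 > 0 ∧ ¬ RootOrbit (extRoot z) (extCoroot φ) (u + v) from
      ⟨this.2, fun h0 ↦ by simp [h0, lin] at this⟩
    have key : u = (Pi.single 0 a, 0) ∧ v = (Pi.single 0 a, 0) ∨ 2 < lin (u + v).1 := by
      rw [Prod.fst_add, lin_add]
      rcases hlinS hu with hu | hu <;> rcases hlinS hv with hv | hv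
      · exact .inl ⟨hu, hv⟩
      all_goals right; simp_all [lin_single]
    obtain ⟨rfl, rfl⟩ | h1 := key
    · refine ⟨by simp [lin_add, lin_single, ha0], fun h0 ↦ ?_⟩
      have h1 := hlin h0
      rw [Prod.fst_add, lin_add, lin_single] at h1
      have h3 : a = 1 := by lia
      have h4 : quad ((Pi.single 0 a : Fin (l + 2) → ℤ) + Pi.single 0 a) = 4 := by
        rw [← Pi.single_add, quad_single, h3]; rfl
      obtain ⟨-, h2 | ⟨m, hm, h2⟩⟩ := hp h0
      · exact absurd (h4.symm.trans h2) (by simp)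
      · rw [h3, one_smul] at hm
        rw [← hm, ← h3] at h2
        exact absurd (h4.symm.trans h2) (by simp [h3])
    · exact ⟨by lia, fun h0 ↦ (hlin h0).not_gt h1⟩
  · have h1 := card_union_le (pairs (l + 2) ∪ Z) (Z.image Neg.neg)
    have h2 := card_union_le (pairs (l + 2)) Z
    have h3 : (Z.image Neg.neg).card ≤ _ := card_image_le
    have h4 := card_pairs_le (n := l + 2)
    have h5 : S.card = (l + 2).choose 2 + 1 := by
      rw [card_insert_of_notMem, card_inds]
      intro h0
      obtain ⟨T, hT, h1⟩ := exists_of_mem_inds h0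
      have h2 := congr_arg lin (Prod.mk.inj h1).1
      have h3 := congr_arg quad (Prod.mk.inj h1).1
      rw [lin_single, lin_ind, hT] at h2
      rw [quad_single, quad_ind, hT, h2] at h3
      simp at h3
    rw [h5, Fintype.card_option, Fintype.card_fin]
    have h6 := two_mul_choose_two (l + 2)
    have h7 : (l + 2) * (l + 2) - (l + 2) = l * l + 3 * l + 2 := by
      rw [← Nat.mul_sub_one]; simp; ring
    have h8 : 3 * l ≤ 3 * (l * l) := by nlinarith [Nat.le_mul_self l]
    lia

theorem hasLargeCommutingSet_fork (l : ℕ) : HasLargeCommutingSet (extCartan (l + 2) l 1 1) := by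
  let x : Fin (l + 3) := ⟨l + 1, by lia⟩
  let y : Fin (l + 3) := ⟨l + 2, by lia⟩
  have hxy : x ≠ y := by simp [x, y]
  let z : Lat (l + 3) := (ind {x, y}, 0)
  let φ : Lat (l + 3) →+ ℤ := coord x + coord y
  have hφ (v) : φ v = v.1 x + v.1 y := rfl
  let p (v : Lat (l + 3)) : Prop := v.2 = 0 ∧ quad v.1 = 2
  have hp {v} (hv : RootOrbit (extRoot z) (extCoroot φ) v) : p v := by
    refine RootOrbit.invariant ?_ ?_ ?_ ?_ hv
    · rintro m t σ ⟨h1, h2⟩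
      exact ⟨h1, (quad_comp _ _).trans h2⟩
    · exact fun i j hij ↦ ⟨rfl, quad_diff hij⟩
    · exact ⟨rfl, by simp [z, quad_ind, hxy]⟩
    · rintro ⟨m, t⟩ ⟨rfl : t = 0, h2⟩
      refine ⟨by simp [z], ?_⟩
      rw [Prod.fst_sub, Prod.smul_fst, quad_sub_smul, quad_ind, card_pair hxy, h2, hφ]
      simp only [z, ind_pair hxy, Pi.add_apply, mul_add, sum_add_distrib, Pi.single_apply, mul_ite,
        mul_one, mul_zero, sum_ite_eq', mem_univ, if_true]
      push_cast
      ring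
  have hS {v} (hv : v ∈ inds (l + 3) 2 0) : lin v.1 = 2 := by
    obtain ⟨T, hT, rfl⟩ := exists_of_mem_inds hv
    simp [lin_ind, hT]
  refine ⟨_, _, extRoot z, extCoroot φ, pairs (l + 3), inds (l + 3) 2 0,
    extCoroot_extRoot ?_ ?_ ?_, ?_, ?_, ?_, ?_⟩
  · simp [hφ, z, ind]
  · intro i
    simp only [hφ, x, y, pathRoot, diff, Pi.sub_apply, Pi.single_apply, Fin.ext_iff,
      Fin.val_castSucc, Fin.val_succ]
    split_ifs <;> lia
  · intro i
    simp only [pathCoroot, z, x, y, AddMonoidHom.sub_apply, coord_apply, ind, mem_insert,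
      mem_singleton, Fin.ext_iff, Fin.val_castSucc, Fin.val_succ]
    split_ifs <;> lia
  · rintro ⟨m, t⟩ hv
    obtain ⟨rfl : t = 0, h1⟩ := hp hv
    exact mem_pairs h1
  · intro v hv
    obtain ⟨T, hT, rfl⟩ := exists_of_mem_inds hv
    exact extendsPath_ext.ind ((card_pair hxy).trans hT.symm) RootOrbit.new
  · intro u hu v hv
    have key : lin (u + v).1 = 4 := by
      rw [Prod.fst_add, lin_add, hS hu, hS hv]; rfl
    refine ⟨fun h0 ↦ ?_, fun h0 ↦ by simp [h0, lin] at key⟩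
    have := lin_le_of_quad_eq_two (hp h0).2
    lia
  · have h4 := card_pairs_le (n := l + 3)
    rw [card_inds, Fintype.card_option, Fintype.card_fin]
    have h6 := two_mul_choose_two (l + 3)
    have h7 : (l + 3) * (l + 3) - (l + 3) = l * l + 5 * l + 6 := by
      rw [← Nat.mul_sub_one]; simp; ring
    lia

lemma exists_ind_of_quad_eq_lin {m : Fin n → ℤ} (h : quad m = lin m) : ∃ T, m = ind T := by
  have h0 : ∑ i, m i * (m i - 1) = 0 := by
    rw [← sub_eq_zero, quad, lin, ← sum_sub_distrib] at h
    rw [← h]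
    exact sum_congr rfl fun i _ ↦ by ring
  rw [sum_eq_zero_iff_of_nonneg] at h0
  · refine ⟨univ.filter fun i ↦ m i = 1, funext fun i ↦ ?_⟩
    have := h0 i (mem_univ i)
    rw [mul_eq_zero] at this
    simp only [ind, mem_filter, mem_univ, true_and]
    split_ifs <;> lia
  · intro i _
    rcases le_or_gt (m i) 0 with h | h
    · exact mul_nonneg_of_nonpos_of_nonpos h (by lia)
    · exact mul_nonneg h.le (by lia)

lemma cases_of_lin_of_quad {m : Fin n → ℤ} {t : ℤ} (hn : n ≤ 8) (ht : 0 ≤ t) (h1 : lin m = 3 * t)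
    (h2 : quad m = t ^ 2 + 2) :
    (m, t) ∈ diffs n ∨ (m, t) ∈ inds n 3 1 ∨ (m, t) ∈ inds n 6 2 ∨
      n = 8 ∧ ∃ j, m = 1 + Pi.single j 1 ∧ t = 3 := by
  have hc : lin m ^ 2 ≤ n * quad m := by
    have := sq_sum_le_card_mul_sum_sq (s := univ) (f := m)
    rwa [card_univ, Fintype.card_fin] at this
  have hshift (c : ℤ) : quad (m - c • 1) = quad m - 2 * c * lin m + c ^ 2 * n := by
    rw [quad_sub_smul]
    simp [lin, quad]
  have hn' : (n : ℤ) ≤ 8 := by exact_mod_cast hn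
  rw [h1, h2] at hc hshift
  have ht4 : t ≤ 4 := by nlinarith
  obtain rfl | rfl | rfl | rfl | rfl : t = 0 ∨ t = 1 ∨ t = 2 ∨ t = 3 ∨ t = 4 := by lia
  · exact .inl (diff_mem_of_quad h2 h1)
  · obtain ⟨T, rfl⟩ := exists_ind_of_quad_eq_lin (h2.trans h1.symm)
    rw [lin_ind] at h1
    exact .inr (.inl (mem_inds (by exact_mod_cast h1)))
  · obtain ⟨T, rfl⟩ := exists_ind_of_quad_eq_lin (h2.trans h1.symm)
    rw [lin_ind] at h1
    exact .inr (.inr (.inl (mem_inds (by exact_mod_cast h1))))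
  · have h3 := hshift 1
    rw [one_smul] at h3
    have h4 := quad_nonneg (m - 1)
    have h5 : lin (m - 1) = 9 - n := by simp [lin_sub, h1]; simp [lin]
    obtain h6 | h6 : quad (m - 1) = 0 ∨ quad (m - 1) = 1 := by lia
    · rw [eq_zero_of_quad h6] at h5
      simp [lin] at h5
      lia
    · obtain ⟨j, hj | hj⟩ := exists_single_of_quad_eq_one h6
      · rw [hj, lin_single] at h5
        exact .inr (.inr (.inr ⟨by lia, j, by rw [← hj]; abel, rfl⟩))
      · rw [hj, lin_neg, lin_single] at h5
        lia
  · have h3 : quad ((2 : ℤ) • m - (3 : ℤ) • 1) = 9 * n - 72 := by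
      have h4 : ∑ i, ((2 : ℤ) • m) i * (1 : Fin n → ℤ) i = 2 * lin m := by simp [lin, mul_sum]
      rw [quad_sub_smul, quad_smul, h4, h1, h2]
      simp [quad]
      ring
    have h5 := quad_nonneg ((2 : ℤ) • m - (3 : ℤ) • 1)
    have h6 : n = 8 := by lia
    subst h6
    have h7 := congr_fun (eq_zero_of_quad (h3.trans (by simp))) 0
    simp at h7
    lia

section Exceptional

variable (l : ℕ)

/-- The last three coordinates. -/
def lastThree : Finset (Fin (l + 4)) := (univ.filter fun i ↦ i.val < l + 1)ᶜ

/-- The additional simple root of type `E`. -/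
def exceptionalRoot : Lat (l + 4) := (ind (lastThree l), 1)

/-- The additional simple coroot of type `E`. -/
def exceptionalCoroot : Lat (l + 4) →+ ℤ := ∑ i ∈ lastThree l, coord i - AddMonoidHom.snd _ _

variable {l}

lemma mem_lastThree {i : Fin (l + 4)} : i ∈ lastThree l ↔ l < i.val := by
  simp only [lastThree, mem_compl, mem_filter, mem_univ, true_and]
  lia

lemma card_lastThree : (lastThree l).card = 3 := by
  rw [lastThree, card_compl, Fin.card_filter_val_lt, Fintype.card_fin]
  lia

lemma exceptionalCoroot_apply (v : Lat (l + 4)) :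
    exceptionalCoroot l v = ∑ i ∈ lastThree l, v.1 i - v.2 := by
  simp [exceptionalCoroot]

lemma exceptionalCoroot_ind (T : Finset (Fin (l + 4))) (t : ℤ) :
    exceptionalCoroot l (ind T, t) = (lastThree l ∩ T).card - t := by
  simp [exceptionalCoroot_apply, ind]

lemma sum_lastThree (m : Fin (l + 4) → ℤ) :
    ∑ i ∈ lastThree l, m i = ∑ i, m i * ind (lastThree l) i := by
  simp [ind]

lemma exceptional_cartan (i j : Option (Fin (l + 3))) :
    extCoroot (exceptionalCoroot l) i (extRoot (exceptionalRoot l) j) =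
      extCartan (l + 3) l 1 1 j i := by
  refine extCoroot_extRoot ?_ ?_ ?_ i j
  · simp [exceptionalRoot, exceptionalCoroot_ind, card_lastThree]
  · intro i
    simp only [exceptionalCoroot_apply, pathRoot, diff, Pi.sub_apply, sum_sub_distrib,
      Pi.single_apply, sum_ite_eq', mem_lastThree, Fin.val_castSucc, Fin.val_succ]
    split_ifs <;> lia
  · intro i
    simp only [pathCoroot, exceptionalRoot, AddMonoidHom.sub_apply, coord_apply, ind,
      mem_lastThree, Fin.val_castSucc, Fin.val_succ]
    split_ifs <;> lia

lemma exceptional_invariant {v : Lat (l + 4)}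
    (hv : RootOrbit (extRoot (exceptionalRoot l)) (extCoroot (exceptionalCoroot l)) v) :
    lin v.1 = 3 * v.2 ∧ quad v.1 = v.2 ^ 2 + 2 := by
  refine RootOrbit.invariant (p := fun v ↦ lin v.1 = 3 * v.2 ∧ quad v.1 = v.2 ^ 2 + 2)
    ?_ ?_ ?_ ?_ hv
  · rintro m t σ ⟨h1, h2⟩
    exact ⟨(lin_comp _ _).trans h1, (quad_comp _ _).trans h2⟩
  · exact fun i j hij ↦ ⟨lin_diff _ _, quad_diff hij⟩
  · simp [exceptionalRoot, quad_ind, lin_ind, card_lastThree]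
  · rintro ⟨m, t⟩ ⟨h1, h2⟩
    have hc := exceptionalCoroot_apply (m, t)
    rw [sum_lastThree] at hc
    simp only at h1 h2 hc
    set c := exceptionalCoroot l (m, t)
    simp only [exceptionalRoot, Prod.fst_sub, Prod.smul_fst, Prod.snd_sub, Prod.smul_snd,
      quad_sub_smul, lin_sub, lin_smul, lin_ind, quad_ind, card_lastThree, h1, h2, smul_eq_mul]
    rw [← eq_sub_iff_add_eq.mp hc.symm.symm]
    constructor <;> push_cast <;> ring

/-- A finite set containing the root system of type `E`. -/
def exceptionalBound (n : ℕ) : Finset (Lat n) :=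
  let W := inds n 3 1 ∪ inds n 6 2 ∪ univ.image fun j ↦ (1 + Pi.single j 1, 3)
  diffs n ∪ W ∪ W.image Neg.neg

lemma card_exceptionalBound_le :
    (exceptionalBound n).card ≤ n * n - n + 2 * (n.choose 3 + n.choose 6 + n) := by
  let W : Finset (Lat n) := inds n 3 1 ∪ inds n 6 2 ∪ univ.image fun j ↦ (1 + Pi.single j 1, 3)
  have h1 : W.card ≤ n.choose 3 + n.choose 6 + n := by
    refine (card_union_le _ _).trans (Nat.add_le_add ?_ (card_image_le.trans (by simp)))
    exact (card_union_le _ _).trans (by simp [card_inds])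
  have h2 : (exceptionalBound n).card ≤ _ := card_union_le (diffs n ∪ W) (W.image Neg.neg)
  have h3 := card_union_le (diffs n) W
  have h4 : (W.image Neg.neg).card ≤ _ := card_image_le
  have h5 := card_diffs_le (n := n)
  lia

lemma mem_exceptionalBound (hl : l ≤ 4) {v : Lat (l + 4)}
    (hv : RootOrbit (extRoot (exceptionalRoot l)) (extCoroot (exceptionalCoroot l)) v) :
    v ∈ exceptionalBound (l + 4) := by
  obtain ⟨m, t⟩ := v
  obtain ⟨h1, h2⟩ := exceptional_invariant hv
  simp only at h1 h2
  rcases le_total 0 t with ht | ht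
  · rcases cases_of_lin_of_quad (by lia) ht h1 h2 with h | h | h | ⟨-, j, rfl, rfl⟩
    · exact mem_union_left _ (mem_union_left _ h)
    all_goals refine mem_union_left _ (mem_union_right _ ?_)
    · exact mem_union_left _ (mem_union_left _ h)
    · exact mem_union_left _ (mem_union_right _ h)
    · exact mem_union_right _ (mem_image_of_mem _ (mem_univ j))
  · have h3 : quad (-m) = (-t) ^ 2 + 2 := by simpa [quad] using h2
    rcases cases_of_lin_of_quad (m := -m) (t := -t) (by lia) (by lia) (by rw [lin_neg]; lia) h3
      with h | h | h | ⟨-, j, h, h'⟩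
    · obtain ⟨⟨i, j⟩, hij, h⟩ := mem_image.mp h
      have h6 : ((m, t) : Lat (l + 4)) = (diff j i, 0) := by
        rw [← neg_neg ((m, t) : Lat (l + 4)), show -((m, t) : Lat (l + 4)) = (-m, -t) from rfl, ← h]
        simp [diff]
      rw [h6]
      exact mem_union_left _ (mem_union_left _ (mem_diffs (mem_offDiag.mp hij).2.2.symm))
    all_goals refine mem_union_right _ (mem_image.mpr ⟨(-m, -t), ?_, by simp⟩)
    · exact mem_union_left _ (mem_union_left _ h)
    · exact mem_union_left _ (mem_union_right _ h)
    · rw [h, h']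
      exact mem_union_right _ (mem_image_of_mem _ (mem_univ j))

lemma RootOrbit.exceptional {T : Finset (Fin (l + 4))} (hT : T.card = 3) :
    RootOrbit (extRoot (exceptionalRoot l)) (extCoroot (exceptionalCoroot l)) (ind T, 1) :=
  extendsPath_ext.ind (card_lastThree.trans hT.symm) RootOrbit.new

lemma exceptional_apply_le (hl : l ≤ 3) {v : Lat (l + 4)} (i : Fin (l + 4))
    (hv : RootOrbit (extRoot (exceptionalRoot l)) (extCoroot (exceptionalCoroot l)) v) :
    v.1 i ≤ 1 := by
  obtain ⟨m, t⟩ := v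
  obtain ⟨h1, h2⟩ := exceptional_invariant hv
  simp only at h1 h2
  have hind (T : Finset (Fin (l + 4))) : 0 ≤ ind T i ∧ ind T i ≤ 1 := by
    rw [ind]; split_ifs <;> simp
  rcases le_total 0 t with ht | ht
  · rcases cases_of_lin_of_quad (by lia) ht h1 h2 with h | h | h | ⟨h, -⟩
    · obtain ⟨⟨a, b⟩, -, h⟩ := mem_image.mp h
      rw [← h]
      simp only [diff, Pi.sub_apply, Pi.single_apply]
      split_ifs <;> simp
    · obtain ⟨T, -, h⟩ := exists_of_mem_inds h
      rw [h]; exact (hind T).2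
    · obtain ⟨T, -, h⟩ := exists_of_mem_inds h
      rw [h]; exact (hind T).2
    · lia
  · have h3 : quad (-m) = (-t) ^ 2 + 2 := by simpa [quad] using h2
    suffices -1 ≤ (-m) i by simp only [Pi.neg_apply] at this; simp only; lia
    rcases cases_of_lin_of_quad (m := -m) (t := -t) (by lia) (by lia) (by rw [lin_neg]; lia) h3
      with h | h | h | ⟨h, -⟩
    · obtain ⟨⟨a, b⟩, -, h⟩ := mem_image.mp h
      rw [← (Prod.mk.inj h).1]
      simp only [diff, Pi.sub_apply, Pi.single_apply]
      split_ifs <;> simp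
    · obtain ⟨T, -, h⟩ := exists_of_mem_inds h
      rw [(Prod.mk.inj h).1]; have := hind T; lia
    · obtain ⟨T, -, h⟩ := exists_of_mem_inds h
      rw [(Prod.mk.inj h).1]; have := hind T; lia
    · lia

theorem hasLargeCommutingSet_exceptional (hl : l = 2 ∨ l = 3) :
    HasLargeCommutingSet (extCartan (l + 3) l 1 1) := by
  let S₁ : Finset (Lat (l + 4)) :=
    (powersetCard 2 (univ.erase 0)).image fun T ↦ (ind (insert 0 T), 1)
  let S₂ : Finset (Lat (l + 4)) := (univ.erase 0).image fun i ↦ (diff 0 i, 0)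
  have hS₁ {T : Finset (Fin (l + 4))} (hT : T ∈ powersetCard 2 (univ.erase 0)) :
      0 ∉ T ∧ T.card = 2 := by
    obtain ⟨h1, h2⟩ := mem_powersetCard.mp hT
    exact ⟨fun h ↦ notMem_erase _ _ (h1 h), h2⟩
  have hS {v} (hv : v ∈ S₁ ∪ S₂) : v.1 0 = 1 := by
    rcases mem_union.mp hv with hv | hv
    · obtain ⟨T, -, rfl⟩ := mem_image.mp hv
      simp [ind]
    · obtain ⟨i, hi, rfl⟩ := mem_image.mp hv
      simp [diff, (ne_of_mem_erase hi).symm]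
  refine ⟨_, _, extRoot (exceptionalRoot l), extCoroot (exceptionalCoroot l),
    exceptionalBound (l + 4), S₁ ∪ S₂, exceptional_cartan, fun v ↦ mem_exceptionalBound (by lia),
    ?_, ?_, ?_⟩
  · intro v hv
    rcases mem_union.mp hv with hv | hv
    · obtain ⟨T, hT, rfl⟩ := mem_image.mp hv
      obtain ⟨h1, h2⟩ := hS₁ hT
      exact RootOrbit.exceptional (by rw [card_insert_of_notMem h1, h2])
    · obtain ⟨i, hi, rfl⟩ := mem_image.mp hv
      exact extendsPath_ext.diff (by lia) (ne_of_mem_erase hi).symm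
  · intro u hu v hv
    have key : (u + v).1 0 = 2 := by rw [Prod.fst_add, Pi.add_apply, hS hu, hS hv]; rfl
    refine ⟨fun h0 ↦ ?_, fun h0 ↦ by simp [h0] at key⟩
    have := exceptional_apply_le (by lia) 0 h0
    lia
  · have h1 : S₁.card = (l + 3).choose 2 := by
      rw [card_image_of_injOn, card_powersetCard, card_erase_of_mem (mem_univ _), card_univ,
        Fintype.card_fin]
      · rfl
      · intro T hT T' hT' h
        have := ind_injective (Prod.mk.inj h).1
        rw [← erase_insert (hS₁ hT).1, this, erase_insert (hS₁ hT').1]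
    have h2 : S₂.card = l + 3 := by
      rw [card_image_of_injOn, card_erase_of_mem (mem_univ _), card_univ, Fintype.card_fin]
      · rfl
      · intro i hi j hj h
        exact (diff_inj (ne_of_mem_erase hi).symm (Prod.mk.inj h).1).2
    have h3 : Disjoint S₁ S₂ := by
      rw [disjoint_left]
      intro v hv hv'
      obtain ⟨T, -, rfl⟩ := mem_image.mp hv
      obtain ⟨i, -, h⟩ := mem_image.mp hv'
      simpa using (Prod.mk.inj h).2
    rw [card_union_of_disjoint h3, h1, h2, Fintype.card_option, Fintype.card_fin]
    have h4 := card_exceptionalBound_le (n := l + 4)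
    rcases hl with rfl | rfl
    · have : (6 : ℕ).choose 3 = 20 ∧ (6 : ℕ).choose 6 = 1 ∧ (5 : ℕ).choose 2 = 10 := by decide
      norm_num [this] at h4 ⊢
      lia
    · have : (7 : ℕ).choose 3 = 35 ∧ (7 : ℕ).choose 6 = 7 ∧ (6 : ℕ).choose 2 = 15 := by decide
      norm_num [this] at h4 ⊢
      lia

theorem hasLargeCommutingSet_exceptional_eight :
    HasLargeCommutingSet (extCartan 7 4 1 1) := by
  let S₂ : Finset (Lat 8) := univ.image fun j ↦ (1 + Pi.single j 1, 3)
  have hS {v} (hv : v ∈ inds 8 6 2 ∪ S₂) : 2 ≤ v.2 := by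
    rcases mem_union.mp hv with hv | hv
    · obtain ⟨T, -, rfl⟩ := exists_of_mem_inds hv
      simp
    · obtain ⟨i, hi, rfl⟩ := mem_image.mp hv
      simp
  have hsix {T : Finset (Fin 8)} (hT : T.card = 6) :
      RootOrbit (extRoot (exceptionalRoot 4)) (extCoroot (exceptionalCoroot 4)) (ind T, 2) := by
    refine extendsPath_ext.ind (S := {0, 1, 2} ∪ lastThree 4) (hT ▸ by decide)
      (RootOrbit.reflect_new (RootOrbit.exceptional (T := {0, 1, 2}) (by decide)) ?_)
    rw [exceptionalCoroot_ind, exceptionalRoot]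
    refine Prod.ext ?_ (by simp; decide)
    simp
    decide
  refine ⟨_, _, extRoot (exceptionalRoot 4), extCoroot (exceptionalCoroot 4),
    exceptionalBound 8, inds 8 6 2 ∪ S₂, exceptional_cartan, fun v ↦ mem_exceptionalBound le_rfl,
    ?_, ?_, ?_⟩
  · intro v hv
    rcases mem_union.mp hv with hv | hv
    · obtain ⟨T, hT, rfl⟩ := exists_of_mem_inds hv
      exact hsix hT
    · obtain ⟨i, hi, rfl⟩ := mem_image.mp hv
      have h5 : RootOrbit (extRoot (exceptionalRoot 4)) (extCoroot (exceptionalCoroot 4))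
          (1 + Pi.single 5 1, 3) := by
        refine RootOrbit.reflect_new (hsix (T := {6, 7}ᶜ) (by decide)) ?_
        rw [exceptionalCoroot_ind, exceptionalRoot]
        refine Prod.ext ?_ (by simp; decide)
        simp
        decide
      convert extendsPath_ext.comp (Equiv.swap 5 i) h5 using 2
      funext j
      simp only [Pi.add_apply, Function.comp_apply, Pi.one_apply, Pi.single_apply,
        Equiv.swap_apply_def]
      split_ifs <;> simp_all
  · intro u hu v hv
    have key : 4 ≤ (u + v).2 := by rw [Prod.snd_add]; have := hS hu; have := hS hv; lia
    refine ⟨fun h0 ↦ ?_, fun h0 ↦ by simp [h0] at key⟩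
    obtain ⟨h1, h2⟩ := exceptional_invariant h0
    rcases cases_of_lin_of_quad le_rfl (by lia) h1 h2 with h | h | h | ⟨-, j, -, h⟩
    · obtain ⟨_, -, h⟩ := mem_image.mp h
      have := (Prod.mk.inj h).2
      lia
    · obtain ⟨_, -, h⟩ := exists_of_mem_inds h
      have := (Prod.mk.inj h).2
      lia
    · obtain ⟨_, -, h⟩ := exists_of_mem_inds h
      have := (Prod.mk.inj h).2
      lia
    · lia
  · have h2 : S₂.card = 8 := by
      rw [card_image_of_injective, card_univ, Fintype.card_fin]
      intro i j h
      have h1 := congr_fun (add_left_cancel (Prod.mk.inj h).1) i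
      rw [Pi.single_eq_same] at h1
      by_contra hij
      rw [Pi.single_eq_of_ne hij] at h1
      exact one_ne_zero h1
    have h3 : Disjoint (inds 8 6 2) S₂ := by
      rw [disjoint_left]
      intro v hv hv'
      obtain ⟨T, -, rfl⟩ := exists_of_mem_inds hv
      obtain ⟨i, -, h⟩ := mem_image.mp hv'
      simpa using (Prod.mk.inj h).2
    rw [card_union_of_disjoint h3, card_inds, h2, Fintype.card_option, Fintype.card_fin]
    have h4 := card_exceptionalBound_le (n := 8)
    have : (8 : ℕ).choose 3 = 56 ∧ (8 : ℕ).choose 6 = 28 := by decide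
    norm_num [this] at h4 ⊢
    lia

end Exceptional

section Computation

variable {k : ℕ}

/-- A simple reflection in root coordinates. -/
def reflectCoords (A : Matrix (Fin k) (Fin k) ℤ) (i : Fin k) (v : Fin k → ℤ) : Fin k → ℤ :=
  v - (∑ j, v j * A j i) • Pi.single i 1

lemma hasLargeCommutingSet_of_words (A : Matrix (Fin k) (Fin k) ℤ)
    (R : List (Fin k → ℤ)) (W : List (List (Fin k) × Fin k))
    (hR : ∀ i, Pi.single i 1 ∈ R) (hR' : ∀ v ∈ R, ∀ i, reflectCoords A i v ∈ R)
    (hW : (W.map fun w ↦ w.1.foldr (reflectCoords A) (Pi.single w.2 1)).Nodup)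
    (hW' : ∀ u ∈ W, ∀ v ∈ W, u.1.foldr (reflectCoords A) (Pi.single u.2 1) +
      v.1.foldr (reflectCoords A) (Pi.single v.2 1) ∉ 0 :: R)
    (hcard : R.length + k ≤ 7 * W.length) : HasLargeCommutingSet A := by
  let x (i : Fin k) : Fin k → ℤ := Pi.single i 1
  let P (i : Fin k) : (Fin k → ℤ) →+ ℤ := ∑ j, A j i • Pi.evalAddMonoidHom _ j
  have hP (i v) : P i v = ∑ j, v j * A j i := by simp [P, mul_comm]
  have horb {v} (hv : RootOrbit x P v) : v ∈ R := by
    induction hv with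
    | simple i => exact hR i
    | reflect i hv ih => rw [hP]; exact hR' _ ih i
  refine ⟨_, _, x, P, R.toFinset,
    (W.map fun w ↦ w.1.foldr (reflectCoords A) (Pi.single w.2 1)).toFinset, ?_, ?_, ?_, ?_, ?_⟩
  · intro i j
    simp [hP, x, Pi.single_apply]
  · exact fun v hv ↦ List.mem_toFinset.mpr (horb hv)
  · intro v hv
    obtain ⟨⟨w, i⟩, -, rfl⟩ := List.mem_map.mp (List.mem_toFinset.mp hv)
    clear hv
    induction w with
    | nil => exact .simple i
    | cons j w ih =>
      have := ih.reflect j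
      rwa [hP] at this
  · intro u hu v hv
    obtain ⟨a, ha, rfl⟩ := List.mem_map.mp (List.mem_toFinset.mp hu)
    obtain ⟨b, hb, rfl⟩ := List.mem_map.mp (List.mem_toFinset.mp hv)
    have := hW' a ha b hb
    rw [List.mem_cons, not_or] at this
    exact ⟨fun h ↦ this.2 (horb h), this.1⟩
  · have := R.toFinset_card_le
    rw [List.toFinset_card_of_nodup hW, List.length_map, Fintype.card_fin]
    lia

end Computation

theorem hasLargeCommutingSet_G₂ : HasLargeCommutingSet CartanMatrix.G₂ := by
  let Q : List (Fin 2 → ℤ) := [![2, 3], ![1, 3], ![1, 2], ![1, 1], ![1, 0], ![0, 1]]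
  refine hasLargeCommutingSet_of_words _ (Q ++ Q.map Neg.neg) [([0, 1], 0), ([1], 0)] ?_ ?_ ?_ ?_ ?_
  all_goals decide +kernel

theorem hasLargeCommutingSet_F₄ : HasLargeCommutingSet CartanMatrix.F₄ := by
  let Q : List (Fin 4 → ℤ) := [![2, 3, 4, 2], ![1, 3, 4, 2], ![1, 2, 4, 2], ![1, 2, 3, 2],
    ![1, 2, 2, 2], ![1, 2, 3, 1], ![1, 1, 2, 2], ![1, 2, 2, 1], ![0, 1, 2, 2], ![1, 2, 2, 0],
    ![1, 1, 2, 1], ![1, 1, 2, 0], ![1, 1, 1, 1], ![0, 1, 2, 1], ![0, 1, 2, 0], ![1, 1, 1, 0],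
    ![0, 1, 1, 1], ![1, 1, 0, 0], ![0, 1, 1, 0], ![0, 0, 1, 1], ![1, 0, 0, 0], ![0, 1, 0, 0],
    ![0, 0, 1, 0], ![0, 0, 0, 1]]
  refine hasLargeCommutingSet_of_words _ (Q ++ Q.map Neg.neg)
    [([0, 1, 2, 3, 1, 2, 1], 0), ([1, 2, 3, 1, 2, 1], 0), ([2, 3, 1, 2, 1], 0),
      ([3, 2, 1, 2, 3, 0, 1], 2), ([3, 1, 2, 1], 0), ([2, 1, 2, 3, 0, 1], 2), ([3, 2, 1], 0),
      ([1, 2, 3, 0, 1], 2)] ?_ ?_ ?_ ?_ ?_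
  all_goals decide +kernel

end LatticeModel

/-- Matrices of integers with the signs of a Cartan matrix which are positive definite: positivity
enters only through the consequence `eq_zero` that a nonnegative vector which is subharmonic on its
support vanishes. -/
structure IsPositiveCartan {ι : Type*} [Fintype ι] (A : ι → ι → ℤ) : Prop where
  diag (i : ι) : A i i = 2
  nonpos {i j : ι} (h : i ≠ j) : A i j ≤ 0
  zero_symm {i j : ι} (h : A i j = 0) : A j i = 0
  eq_zero {c : ι → ℤ} (h0 : ∀ i, 0 ≤ c i) (h : ∀ i, 0 < c i → ∑ j, c j * A j i ≤ 0)
    (i : ι) : c i = 0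

/-- Connected Cartan matrices of finite type. -/
structure IsFiniteCartan {ι : Type*} [Fintype ι] (A : ι → ι → ℤ) : Prop
    extends IsPositiveCartan A where
  connected {T : Set ι} {i : ι} (hi : i ∈ T) (h : ∀ i ∈ T, ∀ j, A i j ≠ 0 → j ∈ T) (j : ι) : j ∈ T

lemma RootPairing.Base.isFiniteCartan_cartanMatrix {ι K V N : Type*} [Finite ι] [Field K]
    [CharZero K] [AddCommGroup V] [Module K V] [AddCommGroup N] [Module K N]
    {Q : RootPairing ι K V N} [Q.IsRootSystem] [Q.IsCrystallographic] [Q.IsReduced]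
    [Q.IsIrreducible] (b : Q.Base) : IsFiniteCartan b.cartanMatrix where
  diag := b.cartanMatrix_apply_same
  nonpos h := b.cartanMatrix_le_zero_of_ne _ _ h
  zero_symm h := b.cartanMatrix_apply_eq_zero_iff_symm.mp h
  eq_zero {c} h0 h i := by
    classical
    obtain ⟨d, hd, hpos⟩ := b.exists_cartanMatrix_mul_diagaonal_posDef
    by_contra hc
    have hc0 : c ≠ 0 := fun h ↦ hc (congr_fun h i)
    have h1 := hpos.dotProduct_mulVec_pos hc0
    have h2 : star c ⬝ᵥ (b.cartanMatrix * Matrix.diagonal d).mulVec c =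
        ∑ j, d j * (c j * ∑ i, c i * b.cartanMatrix i j) := by
      simp only [dotProduct, Matrix.mulVec, star_trivial, Matrix.mul_diagonal, Finset.mul_sum]
      rw [Finset.sum_comm]
      exact Finset.sum_congr rfl fun _ _ ↦ Finset.sum_congr rfl fun _ _ ↦ by ring
    rw [h2] at h1
    refine h1.not_ge (Finset.sum_nonpos fun j _ ↦ ?_)
    refine mul_nonpos_of_nonneg_of_nonpos (hd j).le ?_
    rcases (h0 j).eq_or_lt with hj | hj
    · simp [← hj]
    · exact mul_nonpos_of_nonneg_of_nonpos hj.le (h j hj)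
  connected {T i} hi h j := by
    refine b.induction_on_cartanMatrix (· ∈ T) hi fun k l hk hkl ↦ h k hk l fun h0 ↦ hkl ?_
    exact b.cartanMatrix_apply_eq_zero_iff_symm.mp h0

namespace IsPositiveCartan

open Finset

variable {ι : Type*} [Fintype ι] {A : ι → ι → ℤ}

lemma comp {κ : Type*} [Fintype κ] (hA : IsPositiveCartan A) {f : κ → ι}
    (hf : Function.Injective f) : IsPositiveCartan fun i j ↦ A (f i) (f j) where
  diag i := hA.diag _
  nonpos h := hA.nonpos (hf.ne h)
  zero_symm h := hA.zero_symm h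
  eq_zero {c} h0 h i := by
    classical
    rw [← hf.extend_apply c 0 i]
    refine hA.eq_zero (c := Function.extend f c 0) (fun v ↦ ?_) (fun v hv ↦ ?_) (f i)
    · by_cases hv : ∃ j, f j = v
      · obtain ⟨j, rfl⟩ := hv
        rw [hf.extend_apply]
        exact h0 j
      · rw [Function.extend_apply' _ _ _ hv]
        rfl
    · by_cases hv' : ∃ j, f j = v
      · obtain ⟨j, rfl⟩ := hv'
        rw [hf.extend_apply] at hv
        convert h j hv using 1
        refine (Fintype.sum_of_injective f hf _ _ (fun v hv ↦ ?_) fun a ↦ ?_).symm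
        · rw [Function.extend_apply' _ _ _ hv, Pi.zero_apply, zero_mul]
        · rw [hf.extend_apply]
      · rw [Function.extend_apply' _ _ _ hv'] at hv
        exact absurd hv (lt_irrefl 0)

lemma eq_zero_of_le_sum (hA : IsPositiveCartan A) {c : ι → ℤ} (h0 : ∀ i, 0 ≤ c i)
    (h : ∀ i, 0 < c i → ∃ N : Finset ι, i ∉ N ∧ 2 * c i ≤ ∑ j ∈ N, c j * -A j i) (i : ι) :
    c i = 0 := by
  classical
  refine hA.eq_zero h0 (fun i hi ↦ ?_) i
  obtain ⟨N, hN, h1⟩ := h i hi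
  have h2 : ∑ j ∈ N, c j * -A j i ≤ ∑ j ∈ univ.erase i, c j * -A j i := by
    refine sum_le_sum_of_subset_of_nonneg (fun j hj ↦ ?_) fun j hj _ ↦ ?_
    · exact mem_erase.mpr ⟨fun h ↦ hN (h ▸ hj), mem_univ _⟩
    · exact mul_nonneg (h0 j) (neg_nonneg.mpr (hA.nonpos (ne_of_mem_erase hj)))
  simp only [mul_neg, sum_neg_distrib] at h1 h2
  rw [← add_sum_erase _ _ (mem_univ i), hA.diag]
  lia

lemma ne_zero_symm (hA : IsPositiveCartan A) {i j : ι} (h : A i j ≠ 0) : A j i ≠ 0 :=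
  fun h0 ↦ h (hA.zero_symm h0)

lemma one_le (hA : IsPositiveCartan A) {i j : ι} (hij : i ≠ j) (h : A i j ≠ 0) : 1 ≤ -A i j := by
  have := hA.nonpos hij
  lia

lemma one_le_mul (hA : IsPositiveCartan A) {i j : ι} (hij : i ≠ j) (h : A i j ≠ 0) :
    1 ≤ A i j * A j i := by
  have h1 := hA.one_le hij h
  have h2 := hA.one_le hij.symm (hA.ne_zero_symm h)
  nlinarith

end IsPositiveCartan

/-- The first `k` terms of `p` form a path in the Dynkin diagram of `A`. -/
structure IsDynkinPath {ι : Type*} (A : ι → ι → ℤ) (k : ℕ) (p : ℕ → ι) : Prop where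
  inj {i j : ℕ} (hi : i < k) (hj : j < k) (h : p i = p j) : i = j
  adj {i : ℕ} (hi : i + 1 < k) : A (p i) (p (i + 1)) ≠ 0

namespace IsDynkinPath

open Finset

variable {ι : Type*} {A : ι → ι → ℤ} {k : ℕ} {p : ℕ → ι}

lemma ne (hp : IsDynkinPath A k p) {i j : ℕ} (hi : i < k) (hj : j < k) (h : i ≠ j) : p i ≠ p j :=
  fun h0 ↦ h (hp.inj hi hj h0)

lemma shift (hp : IsDynkinPath A k p) {m l : ℕ} (h : m + l ≤ k) :
    IsDynkinPath A l fun i ↦ p (m + i) where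
  inj hi hj h := by have := hp.inj (by lia) (by lia) h; lia
  adj hi := hp.adj (i := m + _) (by lia)

lemma cons (hp : IsDynkinPath A k p) {d : ι} (hd : ∀ i < k, d ≠ p i) (h : 0 < k → A d (p 0) ≠ 0) :
    IsDynkinPath A (k + 1) fun i ↦ Nat.casesOn i d p where
  inj {i j} hi hj h := by
    cases i <;> cases j
    · rfl
    · exact absurd h (hd _ (by lia))
    · exact absurd h.symm (hd _ (by lia))
    · rw [hp.inj (by lia) (by lia) h]
  adj {i} hi := by
    cases i
    · exact h (by lia)
    · exact hp.adj (by lia)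

variable [Fintype ι]

lemma adj_symm (hp : IsDynkinPath A k p) (hA : IsPositiveCartan A) {i : ℕ} (hi : i + 1 < k) :
    A (p (i + 1)) (p i) ≠ 0 := hA.ne_zero_symm (hp.adj hi)

lemma reverse (hp : IsDynkinPath A k p) (hA : IsPositiveCartan A) :
    IsDynkinPath A k fun i ↦ p (k - 1 - i) where
  inj hi hj h := by have := hp.inj (by lia) (by lia) h; lia
  adj {i} hi := by
    have := hp.adj_symm hA (i := k - 1 - (i + 1)) (by lia)
    rwa [show k - 1 - (i + 1) + 1 = k - 1 - i by lia] at this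

lemma apply_zero_last (hA : IsPositiveCartan A) (hp : IsDynkinPath A (k + 3) p) :
    A (p 0) (p (k + 2)) = 0 := by
  classical
  by_contra h
  have h' := hA.ne_zero_symm h
  let c (v : ι) : ℤ := if v ∈ (range (k + 3)).image p then 1 else 0
  have hc {i : ℕ} (hi : i < k + 3) : c (p i) = 1 :=
    if_pos (mem_image_of_mem _ (mem_range.mpr hi))
  have h0 := hA.eq_zero_of_le_sum (c := c) (fun v ↦ by simp only [c]; split_ifs <;> simp)
    (fun v hv ↦ ?_) (p 0)
  · rw [hc (by lia)] at h0
    exact one_ne_zero h0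
  · have hv : v ∈ (range (k + 3)).image p := by
      by_contra h0
      simp only [c, if_neg h0, lt_irrefl] at hv
    obtain ⟨i, hi, rfl⟩ := mem_image.mp hv
    rw [mem_range] at hi
    have key {a b : ℕ} (ha : a < k + 3) (hb : b < k + 3) (hab : a ≠ b) (hai : a ≠ i) (hbi : b ≠ i)
        (h1 : A (p a) (p i) ≠ 0) (h2 : A (p b) (p i) ≠ 0) : ∃ N : Finset ι, p i ∉ N ∧
          2 * c (p i) ≤ ∑ j ∈ N, c j * -A j (p i) := by
      refine ⟨{p a, p b}, ?_, ?_⟩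
      · simpa using ⟨(hp.ne ha hi hai).symm, (hp.ne hb hi hbi).symm⟩
      · rw [sum_pair (hp.ne ha hb hab), hc ha, hc hb, hc hi]
        have := hA.one_le (hp.ne ha hi hai) h1
        have := hA.one_le (hp.ne hb hi hbi) h2
        lia
    rcases Nat.eq_zero_or_pos i with rfl | hi0
    · exact key (a := 1) (b := k + 2) (by lia) (by lia) (by lia) (by lia) (by lia)
        (hp.adj_symm hA (by lia)) h'
    obtain ⟨i, rfl⟩ : ∃ j, i = j + 1 := ⟨i - 1, by lia⟩
    rcases (show i + 1 ≤ k + 2 by lia).eq_or_lt with h1 | h1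
    · exact key (a := 0) (b := i) (by lia) (by lia) (by lia) (by lia) (by lia)
        (by rwa [h1]) (hp.adj (by lia))
    · exact key (a := i) (b := i + 2) (by lia) (by lia) (by lia) (by lia) (by lia)
        (hp.adj (by lia)) (hp.adj_symm hA (by lia))

lemma apply_eq_zero (hA : IsPositiveCartan A) (hp : IsDynkinPath A k p) {i j : ℕ} (hij : i + 1 < j)
    (hj : j < k) : A (p i) (p j) = 0 := by
  have := (hp.shift (m := i) (l := j - i - 2 + 3) (by lia)).apply_zero_last hA
  rwa [show i + (j - i - 2 + 2) = j by lia] at this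

lemma apply_eq_zero_of_adj (hA : IsPositiveCartan A) (hp : IsDynkinPath A k p) {d : ι} {m i : ℕ}
    (hm : m < k) (hi : i < k) (hd : ∀ i < k, d ≠ p i) (h : A d (p m) ≠ 0) (him : i ≠ m) :
    A d (p i) = 0 := by
  wlog hlt : m < i generalizing m i
  · by_contra h'
    exact h (this hi hm h' him.symm (by lia))
  have := ((hp.shift (m := m) (l := i - m + 1) (by lia)).cons (d := d)
    (fun t ht ↦ hd _ (by lia)) fun _ ↦ h).apply_eq_zero hA (i := 0) (j := i - m + 1)
    (by lia) (by lia)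
  simpa [show m + (i - m) = i by lia] using this

lemma not_capped (hA : IsPositiveCartan A) {r : ℕ} (hp : IsDynkinPath A (r + 1) p) {N N' : Finset ι}
    (hN : ∀ j ∈ N, ∀ t ≤ r, j ≠ p t) (hN' : ∀ j ∈ N', ∀ t ≤ r, j ≠ p t) (hd : Disjoint N N')
    (h : 2 ≤ ∑ j ∈ N, A (p 0) j * A j (p 0))
    (h' : 2 ≤ ∑ j ∈ N', A (p r) j * A j (p r)) : False := by
  classical
  let Q := (range (r + 1)).image p
  have hQ {t : ℕ} (ht : t ≤ r) : p t ∈ Q := mem_image_of_mem _ (mem_range.mpr (by lia))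
  have hQN {v : ι} (hv : v ∈ N) : v ∉ Q := fun h0 ↦ by
    obtain ⟨t, ht, rfl⟩ := mem_image.mp h0
    exact hN _ hv t (by rw [mem_range] at ht; lia) rfl
  have hQN' {v : ι} (hv : v ∈ N') : v ∉ Q := fun h0 ↦ by
    obtain ⟨t, ht, rfl⟩ := mem_image.mp h0
    exact hN' _ hv t (by rw [mem_range] at ht; lia) rfl
  let c (v : ι) : ℤ :=
    if v ∈ Q then 2 else if v ∈ N then -A (p 0) v else if v ∈ N' then -A (p r) v else 0
  have hc {t : ℕ} (ht : t ≤ r) : c (p t) = 2 := if_pos (hQ ht)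
  have hcN {v : ι} (hv : v ∈ N) : c v = -A (p 0) v := by simp [c, hv, hQN hv]
  have hcN' {v : ι} (hv : v ∈ N') : c v = -A (p r) v := by
    simp [c, hv, hQN' hv, disjoint_right.mp hd hv]
  have h0 := hA.eq_zero_of_le_sum (c := c) (fun v ↦ ?_) (fun v hv ↦ ?_) (p 0)
  · rw [hc (by lia)] at h0
    exact two_ne_zero h0
  · simp only [c]
    split_ifs with h1 h2 h3
    · simp
    · exact neg_nonneg.mpr (hA.nonpos (hN v h2 0 (by lia)).symm)
    · exact neg_nonneg.mpr (hA.nonpos (hN' v h3 r le_rfl).symm)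
    · rfl
  by_cases h1 : v ∈ Q
  · obtain ⟨t, ht, rfl⟩ := mem_image.mp h1
    have ht : t ≤ r := by rw [mem_range] at ht; lia
    have hleft : ∃ F : Finset ι, (∀ j ∈ F, j ∈ N ∨ ∃ u < t, j = p u) ∧
        2 ≤ ∑ j ∈ F, c j * -A j (p t) := by
      cases t with
      | zero =>
        refine ⟨N, fun j hj ↦ .inl hj, h.trans (sum_congr rfl fun j hj ↦ ?_).le⟩
        rw [hcN hj]; ring
      | succ t =>
        refine ⟨{p t}, fun j hj ↦ .inr ⟨t, by lia, mem_singleton.mp hj⟩, ?_⟩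
        rw [sum_singleton, hc (by lia)]
        have := hA.one_le (hp.ne (by lia) (by lia) (by lia)) (hp.adj (i := t) (by lia))
        lia
    have hright : ∃ F : Finset ι, (∀ j ∈ F, j ∈ N' ∨ ∃ u ≤ r, t < u ∧ j = p u) ∧
        2 ≤ ∑ j ∈ F, c j * -A j (p t) := by
      rcases ht.eq_or_lt with rfl | ht
      · refine ⟨N', fun j hj ↦ .inl hj, h'.trans (sum_congr rfl fun j hj ↦ ?_).le⟩
        rw [hcN' hj]; ring
      · refine ⟨{p (t + 1)}, fun j hj ↦ .inr ⟨t + 1, by lia, by lia, mem_singleton.mp hj⟩, ?_⟩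
        rw [sum_singleton, hc (by lia)]
        have := hA.one_le (hp.ne (by lia) (by lia) (by lia)) (hp.adj_symm hA (i := t) (by lia))
        lia
    obtain ⟨F, hF, hF2⟩ := hleft
    obtain ⟨F', hF', hF2'⟩ := hright
    refine ⟨F ∪ F', fun h0 ↦ ?_, ?_⟩
    · rcases mem_union.mp h0 with h0 | h0
      · rcases hF _ h0 with h0 | ⟨u, hu, h0⟩
        · exact hN _ h0 t ht rfl
        · exact hp.ne (by lia) (by lia) (by lia) h0
      · rcases hF' _ h0 with h0 | ⟨u, hu, hu', h0⟩
        · exact hN' _ h0 t ht rfl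
        · exact hp.ne (by lia) (by lia) (by lia) h0
    · rw [sum_union, hc ht]
      · lia
      · rw [disjoint_left]
        intro j hj hj'
        rcases hF _ hj with hj | ⟨u, hu, rfl⟩ <;> rcases hF' _ hj' with hj' | ⟨u', hu', hu'', h0⟩
        · exact disjoint_left.mp hd hj hj'
        · exact hN _ hj u' hu' h0
        · exact hN' _ hj' u (by lia) rfl
        · exact hp.ne (by lia) (by lia) (by lia) h0
  by_cases h2 : v ∈ N
  · refine ⟨{p 0}, fun h3 ↦ hN v h2 0 (by lia) (mem_singleton.mp h3), ?_⟩
    rw [sum_singleton, hc (by lia), hcN h2]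
  by_cases h3 : v ∈ N'
  · refine ⟨{p r}, fun h4 ↦ hN' v h3 r le_rfl (mem_singleton.mp h4), ?_⟩
    rw [sum_singleton, hc le_rfl, hcN' h3]
  · simp [c, h1, h2, h3] at hv

lemma tripod_lt (hA : IsPositiveCartan A) (hp : IsDynkinPath A k p) {s m : ℕ} {q : ℕ → ι}
    (hq : IsDynkinPath A s q) (hm : m < k) (hs : 0 < s) (hpq : ∀ i < k, ∀ t < s, q t ≠ p i)
    (h : A (q 0) (p m) ≠ 0) :
    ((m + 1) * (k - m) * (s + 1) : ℤ) <
      (k - m) * (s + 1) + (m + 1) * (s + 1) + (m + 1) * (k - m) := by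
  classical
  by_contra! hle
  have hk : (0 : ℤ) < k - m := by lia
  let f : Fin k ⊕ Fin s → ι := Sum.elim (fun i ↦ p i) (fun t ↦ q t)
  have hf : Function.Injective f := by
    rintro (i | i) (j | j) hij
    · exact congr_arg _ (Fin.ext (hp.inj i.2 j.2 hij))
    · exact absurd hij.symm (hpq i i.2 j j.2)
    · exact absurd hij (hpq j j.2 i i.2)
    · exact congr_arg _ (Fin.ext (hq.inj i.2 j.2 hij))
  let g : Fin k ⊕ Fin s → ℤ := Sum.elim
    (fun i ↦ if i.val ≤ m then ((i : ℕ) + 1) * (k - m) * (s + 1)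
      else (k - (i : ℕ)) * (m + 1) * (s + 1))
    (fun t ↦ (s - (t : ℕ)) * (m + 1) * (k - m))
  let c : ι → ℤ := Function.extend f g 0
  have hcp {i : ℕ} (hi : i < k) : c (p i) =
      (if i ≤ m then ((i : ℤ) + 1) * (k - m) * (s + 1)
        else ((k : ℤ) - i) * (m + 1) * (s + 1)) :=
    hf.extend_apply g 0 (.inl ⟨i, hi⟩)
  have hcq {t : ℕ} (ht : t < s) : c (q t) = (s - t) * (m + 1) * (k - m) :=
    hf.extend_apply g 0 (.inr ⟨t, ht⟩)
  have hcp0 {i : ℕ} (hi : i < k) : 0 ≤ c (p i) := by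
    rw [hcp hi]
    split_ifs
    · positivity
    · have : (0 : ℤ) ≤ k - i := by lia
      positivity
  have hcq0 {t : ℕ} (ht : t < s) : 0 ≤ c (q t) := by
    have : (0 : ℤ) ≤ s - t := by lia
    rw [hcq ht]
    positivity
  have hmul {a b : ι} (hab : a ≠ b) (h : A a b ≠ 0) (hc : 0 ≤ c a) : c a ≤ c a * -A a b := by
    nlinarith [hA.one_le hab h]
  have h0 := hA.eq_zero_of_le_sum (c := c) (fun v ↦ ?_) (fun v hv ↦ ?_) (p m)
  · rw [hcp hm, if_pos le_rfl] at h0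
    exact absurd h0 (by positivity : (0 : ℤ) < (m + 1) * (k - m) * (s + 1)).ne'
  · by_cases hv : ∃ j, f j = v
    · obtain ⟨j | j, rfl⟩ := hv
      · exact hcp0 j.2
      · exact hcq0 j.2
    · exact (Function.extend_apply' g (0 : ι → ℤ) _ hv).ge
  by_cases hv' : ∃ j, f j = v
  swap
  · rw [show c v = 0 from Function.extend_apply' g (0 : ι → ℤ) _ hv'] at hv
    exact absurd hv (lt_irrefl 0)
  obtain ⟨⟨i, hi⟩ | ⟨t, ht⟩, rfl⟩ := hv'
  · change ∃ N : Finset ι, p i ∉ N ∧ 2 * c (p i) ≤ ∑ j ∈ N, c j * -A j (p i)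
    have hleft : ∃ F : Finset ι, (∀ j ∈ F, ∃ u < i, j = p u) ∧
        (if i ≤ m then (i : ℤ) * (k - m) * (s + 1) else ((k : ℤ) - i + 1) * (m + 1) * (s + 1)) ≤
          ∑ j ∈ F, c j * -A j (p i) := by
      cases i with
      | zero => exact ⟨∅, by simp⟩
      | succ i =>
        refine ⟨{p i}, by simpa using ⟨i, le_rfl, rfl⟩, ?_⟩
        rw [sum_singleton]
        refine le_trans ?_ (hmul (hp.ne (by lia) hi (by lia)) (hp.adj hi) (hcp0 (by lia)))
        rw [hcp (by lia)]
        push_cast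
        split_ifs with h1 h2 h2
        · rfl
        · lia
        · obtain rfl : i = m := by lia
          exact le_of_eq (by ring)
        · exact le_of_eq (by ring)
    have hright : ∃ F : Finset ι, (∀ j ∈ F, ∃ u < k, i < u ∧ j = p u) ∧
        (if i < m then ((i : ℤ) + 2) * (k - m) * (s + 1)
          else ((k : ℤ) - i - 1) * (m + 1) * (s + 1)) ≤
          ∑ j ∈ F, c j * -A j (p i) := by
      rcases (show i + 1 ≤ k from hi).eq_or_lt with h1 | h1
      · refine ⟨∅, by simp, ?_⟩
        rw [if_neg (by lia), ← h1]
        simp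
      · refine ⟨{p (i + 1)}, by simpa using ⟨i + 1, h1, by lia, rfl⟩, ?_⟩
        rw [sum_singleton]
        refine le_trans ?_ (hmul (hp.ne h1 hi (by lia)) (hp.adj_symm hA h1) (hcp0 h1))
        rw [hcp h1]
        push_cast
        split_ifs with h2 h3 h3
        · exact le_of_eq (by ring)
        · lia
        · lia
        · exact le_of_eq (by ring)
    obtain ⟨F, hF, hF2⟩ := hleft
    obtain ⟨F', hF', hF2'⟩ := hright
    have hd : Disjoint F F' := by
      rw [disjoint_left]
      intro j hj hj'
      obtain ⟨u, hu, rfl⟩ := hF _ hj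
      obtain ⟨u', hu', hu'', h0⟩ := hF' _ hj'
      exact hp.ne (by lia) (by lia) (by lia) h0
    have hi' : p i ∉ F ∪ F' := fun h0 ↦ by
      rcases mem_union.mp h0 with h0 | h0
      · obtain ⟨u, hu, h0⟩ := hF _ h0
        exact hp.ne (by lia) (by lia) (by lia) h0
      · obtain ⟨u, hu, hu', h0⟩ := hF' _ h0
        exact hp.ne (by lia) (by lia) (by lia) h0
    rw [hcp hi]
    rcases lt_trichotomy i m with him | rfl | him
    · refine ⟨F ∪ F', hi', ?_⟩
      rw [sum_union hd]
      rw [if_pos him.le] at hF2 ⊢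
      rw [if_pos him] at hF2'
      linarith
    · have hq0 : q 0 ∉ F ∪ F' := fun h0 ↦ by
        rcases mem_union.mp h0 with h0 | h0
        · obtain ⟨u, hu, h0⟩ := hF _ h0
          exact hpq u (by lia) 0 hs h0
        · obtain ⟨u, hu, hu', h0⟩ := hF' _ h0
          exact hpq u (by lia) 0 hs h0
      refine ⟨insert (q 0) (F ∪ F'), ?_, ?_⟩
      · rw [mem_insert, not_or]
        exact ⟨(hpq i hi 0 hs).symm, hi'⟩
      · rw [sum_insert hq0, sum_union hd]
        have := hmul (hpq i hi 0 hs) h (hcq0 hs)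
        rw [hcq hs] at this ⊢
        rw [if_pos le_rfl] at hF2 ⊢
        rw [if_neg (lt_irrefl i)] at hF2'
        push_cast at this ⊢
        linarith
    · refine ⟨F ∪ F', hi', ?_⟩
      rw [sum_union hd]
      rw [if_neg (by lia)] at hF2 hF2' ⊢
      linarith
  · change ∃ N : Finset ι, q t ∉ N ∧ 2 * c (q t) ≤ ∑ j ∈ N, c j * -A j (q t)
    have hleft : ∃ a, a ≠ q t ∧ (∀ u < s, t < u → q u ≠ a) ∧
        ((s : ℤ) - t + 1) * (m + 1) * (k - m) ≤ c a * -A a (q t) := by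
      cases t with
      | zero =>
        refine ⟨p m, (hpq m hm 0 hs).symm, fun u hu _ ↦ hpq m hm u hu, ?_⟩
        refine le_trans ?_ (hmul (hpq m hm 0 hs).symm (hA.ne_zero_symm h) (hcp0 hm))
        rw [hcp hm, if_pos le_rfl]
        push_cast
        exact le_of_eq (by ring)
      | succ t =>
        refine ⟨q t, hq.ne (by lia) ht (by lia), fun u hu _ ↦ hq.ne hu (by lia) (by lia), ?_⟩
        refine le_trans ?_ (hmul (hq.ne (by lia) ht (by lia)) (hq.adj ht) (hcq0 (by lia)))
        rw [hcq (by lia)]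
        push_cast
        exact le_of_eq (by ring)
    obtain ⟨a, ha, ha', hac⟩ := hleft
    rcases (show t + 1 ≤ s from ht).eq_or_lt with h1 | h1
    · refine ⟨{a}, fun h0 ↦ ha (mem_singleton.mp h0).symm, ?_⟩
      rw [sum_singleton, hcq ht]
      rw [← h1] at hac ⊢
      push_cast at hac ⊢
      linarith
    · refine ⟨{a, q (t + 1)}, ?_, ?_⟩
      · simpa using ⟨ha.symm, hq.ne ht h1 (by lia)⟩
      · rw [sum_pair (ha' _ h1 (by lia)).symm]
        have := hmul (hq.ne h1 ht (by lia)) (hq.adj_symm hA h1) (hcq0 h1)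
        rw [hcq h1] at this ⊢
        rw [hcq ht]
        push_cast at this ⊢
        linarith

lemma mul_apply_lt_two (hA : IsPositiveCartan A) (hp : IsDynkinPath A 5 p) :
    A (p 2) (p 3) * A (p 3) (p 2) < 2 := by
  by_contra! hle
  have h1 {i : ℕ} (hi : i + 1 < 5) : 1 ≤ -A (p i) (p (i + 1)) :=
    hA.one_le (hp.ne (by lia) hi (by lia)) (hp.adj hi)
  have h2 {i : ℕ} (hi : i + 1 < 5) : 1 ≤ -A (p (i + 1)) (p i) :=
    hA.one_le (hp.ne hi (by lia) (by lia)) (hp.adj_symm hA hi)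
  obtain ⟨u, hu0, hu, hu'⟩ : ∃ u : ℤ, 0 < u ∧ 2 ≤ u * -A (p 3) (p 2) ∧ u ≤ -A (p 2) (p 3) := by
    have h23 := h1 (i := 2) (by lia)
    have h32 := h2 (i := 2) (by lia)
    rcases (h32).eq_or_lt with h | h
    · exact ⟨2, by lia, by lia, by nlinarith⟩
    · exact ⟨1, by lia, by lia, h23⟩
  let c : Fin 5 → ℤ := ![1, 2, 3, 2 * u, u]
  have hf : Function.Injective fun i : Fin 5 ↦ p i := fun i j h ↦ Fin.ext (hp.inj i.2 j.2 h)
  have h0 := (hA.comp hf).eq_zero_of_le_sum (c := c) (fun i ↦ ?_) (fun i _ ↦ ?_) 0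
  · simp [c] at h0
  · fin_cases i <;> simp [c] <;> lia
  · have h01 := h1 (i := 0) (by lia)
    have h12 := h1 (i := 1) (by lia)
    have h34 := h1 (i := 3) (by lia)
    have h10 := h2 (i := 0) (by lia)
    have h21 := h2 (i := 1) (by lia)
    have h43 := h2 (i := 3) (by lia)
    fin_cases i
    · exact ⟨{1}, by simp, by simp [c]; lia⟩
    · exact ⟨{0, 2}, by simp, by simp [c]; lia⟩
    · exact ⟨{1, 3}, by simp, by simp [c]; lia⟩
    · exact ⟨{2, 4}, by simp, by simp [c]; nlinarith⟩
    · exact ⟨{3}, by simp, by simp [c]; nlinarith⟩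

end IsDynkinPath

lemma IsPositiveCartan.star_lt {ι : Type*} [Fintype ι] {A : ι → ι → ℤ} (hA : IsPositiveCartan A)
    {s : ι} {N : Finset ι} (hs : s ∉ N) : ∑ j ∈ N, A s j * A j s < 4 := by
  classical
  by_contra! hle
  let c (v : ι) : ℤ := if v = s then 2 else if v ∈ N then -A s v else 0
  have hcN {v : ι} (hv : v ∈ N) : c v = -A s v := by
    have : v ≠ s := by rintro rfl; exact hs hv
    simp [c, hv, this]
  have hcs : c s = 2 := if_pos rfl
  have h0 := hA.eq_zero_of_le_sum (c := c) (fun v ↦ ?_) (fun v hv ↦ ?_) s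
  · rw [hcs] at h0
    exact two_ne_zero h0
  · simp only [c]
    split_ifs with h1
    · simp
    · exact neg_nonneg.mpr (hA.nonpos (Ne.symm h1))
    · rfl
  · by_cases h1 : v = s
    · subst h1
      refine ⟨N, hs, ?_⟩
      rw [hcs]
      exact hle.trans (Finset.sum_congr rfl fun j hj ↦ by rw [hcN hj]; ring).le
    by_cases h2 : v ∈ N
    · refine ⟨{s}, by simpa using h1, ?_⟩
      rw [Finset.sum_singleton, hcs, hcN h2]
    · simp [c, h1, h2] at hv

lemma IsPositiveCartan.eq_neg_one {ι : Type*} [Fintype ι] {A : ι → ι → ℤ} (hA : IsPositiveCartan A)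
    {i j : ι} (hij : i ≠ j) (h : A i j ≠ 0) (hlt : A i j * A j i < 2) :
    A i j = -1 ∧ A j i = -1 := by
  have h1 := hA.one_le hij h
  have h2 := hA.one_le hij.symm (hA.ne_zero_symm h)
  constructor <;> nlinarith

namespace IsDynkinPath

open Finset

variable {ι : Type*} {A : ι → ι → ℤ} {k : ℕ} {p : ℕ → ι} [Fintype ι]

lemma one_le_mul (hA : IsPositiveCartan A) (hp : IsDynkinPath A k p) {i : ℕ} (hi : i + 1 < k) :
    1 ≤ A (p i) (p (i + 1)) * A (p (i + 1)) (p i) :=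
  hA.one_le_mul (hp.ne (by lia) hi (by lia)) (hp.adj hi)

lemma apply_eq_pathCartan (hA : IsPositiveCartan A) (hp : IsDynkinPath A k p)
    (hw : ∀ i, i + 1 < k → A (p i) (p (i + 1)) * A (p (i + 1)) (p i) < 2) {i j : ℕ} (hi : i < k)
    (hj : j < k) : A (p i) (p j) = pathCartan i j := by
  rw [pathCartan]
  split_ifs with h1 h2
  · rw [h1, hA.diag]
  · rcases h2 with rfl | rfl
    · exact (hA.eq_neg_one (hp.ne hi hj h1) (hp.adj hj) (hw i hj)).1
    · exact (hA.eq_neg_one (hp.ne hj hi (Ne.symm h1)) (hp.adj hi) (hw j hi)).2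
  · rcases lt_or_gt_of_ne h1 with h | h
    · exact hp.apply_eq_zero hA (by lia) hj
    · exact hA.zero_symm (hp.apply_eq_zero hA (by lia) hi)

lemma mul_lt_two_of_ne (hA : IsPositiveCartan A) (hp : IsDynkinPath A k p) {i j : ℕ}
    (hi : i + 1 < k) (hj : j + 1 < k) (hij : i ≠ j)
    (h : 2 ≤ A (p j) (p (j + 1)) * A (p (j + 1)) (p j)) :
    A (p i) (p (i + 1)) * A (p (i + 1)) (p i) < 2 := by
  by_contra! h'
  wlog hlt : i < j generalizing i j
  · exact this hj hi hij.symm h' h (by lia)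
  refine (hp.shift (m := i + 1) (l := j - i - 1 + 1) (by lia)).not_capped hA (N := {p i})
    (N' := {p (j + 1)}) (fun v hv t ht ↦ ?_) (fun v hv t ht ↦ ?_) ?_ ?_ ?_
  · rw [mem_singleton.mp hv]
    exact hp.ne (by lia) (by lia) (by lia)
  · rw [mem_singleton.mp hv]
    exact hp.ne (by lia) (by lia) (by lia)
  · simpa using hp.ne (by lia) (by lia) (by lia)
  · rw [sum_singleton, mul_comm]
    exact h'
  · rwa [sum_singleton, show i + 1 + (j - i - 1) = j by lia]

lemma hasLargeCommutingSet_of_equiv {κ : Type*} [Fintype κ] {B : κ → κ → ℤ} {f : κ → ι}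
    (hf : f.Bijective) (hB : HasLargeCommutingSet B) (h : ∀ i j, A (f i) (f j) = B i j) :
    HasLargeCommutingSet A := by
  refine .of_equiv (Equiv.ofBijective f hf) ?_
  convert hB using 3
  exact h _ _

lemma hasLargeCommutingSet_of_fin (hp : IsDynkinPath A k p) (hc : ∀ v, ∃ i < k, v = p i)
    {B : Fin k → Fin k → ℤ} (hB : HasLargeCommutingSet B)
    (h : ∀ i j : Fin k, A (p i) (p j) = B i j) : HasLargeCommutingSet A := by
  refine hasLargeCommutingSet_of_equiv (f := fun i : Fin k ↦ p i)
    ⟨fun i j hij ↦ Fin.ext (hp.inj i.2 j.2 hij), fun v ↦ ?_⟩ hB h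
  obtain ⟨i, hi, rfl⟩ := hc v
  exact ⟨⟨i, hi⟩, rfl⟩

lemma hasLargeCommutingSet_of_ext (hA : IsPositiveCartan A) (hp : IsDynkinPath A k p)
    (hw : ∀ i, i + 1 < k → A (p i) (p (i + 1)) * A (p (i + 1)) (p i) < 2) {d : ι}
    (hd : ∀ i < k, d ≠ p i) (hc : ∀ v, v = d ∨ ∃ i < k, v = p i) {q : ℕ} {a b : ℤ}
    (hq : ∀ i < k, i ≠ q → A d (p i) = 0) (ha : A d (p q) = -a) (hb : A (p q) d = -b)
    (hB : HasLargeCommutingSet (extCartan k q a b)) : HasLargeCommutingSet A := by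
  refine hasLargeCommutingSet_of_equiv (f := fun i : Option (Fin k) ↦ i.elim d fun i ↦ p i)
    ⟨?_, fun v ↦ ?_⟩ hB ?_
  · rintro (_ | i) (_ | j) hij
    · rfl
    · exact absurd hij (hd j j.2)
    · exact absurd hij.symm (hd i i.2)
    · exact congr_arg some (Fin.ext (hp.inj i.2 j.2 hij))
  · obtain rfl | ⟨i, hi, rfl⟩ := hc v
    · exact ⟨none, rfl⟩
    · exact ⟨some ⟨i, hi⟩, rfl⟩
  · rintro (_ | i) (_ | j)
    · exact hA.diag d
    · simp only [extCartan, Option.elim]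
      split_ifs with h
      · rw [h, ha]
      · exact hq j j.2 h
    · simp only [extCartan, Option.elim]
      split_ifs with h
      · rw [h, hb]
      · exact hA.zero_symm (hq i i.2 h)
    · exact hp.apply_eq_pathCartan hA hw i.2 j.2

lemma cover_reverse {α : Type*} {p : ℕ → α} (hc : ∀ v, ∃ i < k, v = p i) (v : α) :
    ∃ i < k, v = p (k - 1 - i) := by
  obtain ⟨i, hi, rfl⟩ := hc v
  exact ⟨k - 1 - i, by lia, by rw [show k - 1 - (k - 1 - i) = i by lia]⟩

lemma hasLargeCommutingSet_of_neg_three (hA : IsPositiveCartan A) (hp : IsDynkinPath A 2 p)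
    (hc : ∀ v, ∃ i < 2, v = p i) (h : A (p 0) (p 1) = -3) (h' : A (p 1) (p 0) = -1) :
    HasLargeCommutingSet A := by
  refine hp.hasLargeCommutingSet_of_fin hc LatticeModel.hasLargeCommutingSet_G₂ fun i j ↦ ?_
  fin_cases i <;> fin_cases j <;> simp [CartanMatrix.G₂, hA.diag, h, h']

lemma hasLargeCommutingSet_of_neg_two (hA : IsPositiveCartan A) (hp : IsDynkinPath A 4 p)
    (hc : ∀ v, ∃ i < 4, v = p i) (h : A (p 1) (p 2) = -2) (h' : A (p 2) (p 1) = -1)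
    (h01 : A (p 0) (p 1) * A (p 1) (p 0) < 2) (h23 : A (p 2) (p 3) * A (p 3) (p 2) < 2) :
    HasLargeCommutingSet A := by
  refine hp.hasLargeCommutingSet_of_fin hc LatticeModel.hasLargeCommutingSet_F₄ fun i j ↦ ?_
  obtain ⟨h01, h10⟩ := hA.eq_neg_one (hp.ne (by lia) (by lia) (by lia)) (hp.adj (by lia)) h01
  obtain ⟨h23, h32⟩ := hA.eq_neg_one (hp.ne (by lia) (by lia) (by lia)) (hp.adj (by lia)) h23
  have h02 : A (p 0) (p 2) = 0 := hp.apply_eq_zero hA (by lia) (by lia)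
  have h03 : A (p 0) (p 3) = 0 := hp.apply_eq_zero hA (by lia) (by lia)
  have h13 : A (p 1) (p 3) = 0 := hp.apply_eq_zero hA (by lia) (by lia)
  fin_cases i <;> fin_cases j <;> simp [CartanMatrix.F₄, hA.diag, h, h', h01, h10, h23, h32, h02,
    h03, h13, hA.zero_symm h02, hA.zero_symm h03, hA.zero_symm h13]

lemma hasLargeCommutingSet_of_two_le (hA : IsPositiveCartan A) (hp : IsDynkinPath A k p)
    (hc : ∀ v, ∃ i < k, v = p i) {n : ℕ} (hn : n + 1 < k)
    (h : 2 ≤ A (p n) (p (n + 1)) * A (p (n + 1)) (p n)) : HasLargeCommutingSet A := by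
  classical
  wlog hkn : k ≤ 2 * n + 2 generalizing p n
  · refine this (hp.reverse hA) (cover_reverse hc) (n := k - 2 - n) (by lia) ?_ (by lia)
    rwa [show k - 1 - (k - 2 - n) = n + 1 by lia,
      show k - 1 - (k - 2 - n + 1) = n by lia, mul_comm]
  have hw {i : ℕ} (hi : i + 1 < k) (hin : i ≠ n) := hp.mul_lt_two_of_ne hA hi hn hin h
  have hne : p n ≠ p (n + 1) := hp.ne (by lia) hn (by lia)
  have h1 := hA.one_le hne (hp.adj hn)
  have h2 := hA.one_le hne.symm (hp.adj_symm hA hn)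
  have h4 : A (p n) (p (n + 1)) * A (p (n + 1)) (p n) < 4 := by
    simpa using hA.star_lt (s := p n) (N := {p (n + 1)}) (by simpa using hne)
  have hcase : ∃ a b, A (p n) (p (n + 1)) = -a ∧ A (p (n + 1)) (p n) = -b ∧
      (a = 1 ∧ b = 2 ∨ a = 2 ∧ b = 1 ∨ a = 1 ∧ b = 3 ∨ a = 3 ∧ b = 1) := by
    refine ⟨-A (p n) (p (n + 1)), -A (p (n + 1)) (p n), by ring, by ring, ?_⟩
    generalize hx : -A (p n) (p (n + 1)) = x at *
    generalize hy : -A (p (n + 1)) (p n) = y at *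
    have h5 : x * y < 4 := by rw [← hx, ← hy]; linarith
    have h6 : 2 ≤ x * y := by rw [← hx, ← hy]; linarith
    have hx4 : x < 4 := by nlinarith
    have hy4 : y < 4 := by nlinarith
    interval_cases x <;> interval_cases y <;> simp_all
  have h3 (h3 : A (p n) (p (n + 1)) * A (p (n + 1)) (p n) = 3) : n = 0 ∧ k = 2 := by
    have hn0 : n = 0 := by
      by_contra h0
      obtain ⟨n, rfl⟩ : ∃ i, n = i + 1 := ⟨n - 1, by lia⟩
      have := hA.star_lt (s := p (n + 1)) (N := {p n, p (n + 1 + 1)}) (by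
        simpa using ⟨hp.ne (by lia) (by lia) (by lia), hne⟩)
      rw [sum_pair (hp.ne (by lia) (by lia) (by lia))] at this
      linarith [hp.one_le_mul hA (i := n) (by lia)]
    lia
  obtain ⟨a, b, ha, hb, hab⟩ := hcase
  rcases (show n + 2 ≤ k from hn).eq_or_lt with rfl | hnk
  · by_cases h5 : a = 1 ∧ b = 2 ∨ a = 2 ∧ b = 1
    · have hp' : IsDynkinPath A (n + 1) p := by simpa using hp.shift (m := 0) (l := n + 1) (by lia)
      refine hp'.hasLargeCommutingSet_of_ext hA (fun i hi ↦ hw (by lia) (by lia)) (d := p (n + 1))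
        (fun i hi ↦ hp.ne (by lia) (by lia) (by lia)) (fun v ↦ ?_) (q := n) (fun i hi hin ↦ ?_)
        hb ha (LatticeModel.hasLargeCommutingSet_double_end n (by lia))
      · obtain ⟨i, hi, rfl⟩ := hc v
        rcases (show i ≤ n + 1 by lia).eq_or_lt with rfl | hi'
        · exact .inl rfl
        · exact .inr ⟨i, hi', rfl⟩
      · exact hA.zero_symm (hp.apply_eq_zero hA (by lia) (by lia))
    · obtain ⟨rfl, -⟩ := h3 (by
        rw [ha, hb]; rcases hab with h | h | ⟨rfl, rfl⟩ | ⟨rfl, rfl⟩ <;> simp_all)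
      obtain ⟨rfl, rfl⟩ | ⟨rfl, rfl⟩ : a = 3 ∧ b = 1 ∨ a = 1 ∧ b = 3 := by lia
      · exact hp.hasLargeCommutingSet_of_neg_three hA hc ha hb
      · exact (hp.reverse hA).hasLargeCommutingSet_of_neg_three hA (cover_reverse hc) hb ha
  have hab : a = 1 ∧ b = 2 ∨ a = 2 ∧ b = 1 := by
    by_contra h5
    have := h3 (by rw [ha, hb]; rcases hab with h | h | ⟨rfl, rfl⟩ | ⟨rfl, rfl⟩ <;> simp_all)
    lia
  by_cases hk : k = 4
  · obtain rfl : n = 1 := by lia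
    subst hk
    have h01 := hw (i := 0) (by lia) (by lia)
    have h23 := hw (i := 2) (by lia) (by lia)
    obtain ⟨rfl, rfl⟩ | ⟨rfl, rfl⟩ := hab
    · exact (hp.reverse hA).hasLargeCommutingSet_of_neg_two hA (cover_reverse hc) hb ha
        (by rwa [mul_comm]) (by rwa [mul_comm])
    · exact hp.hasLargeCommutingSet_of_neg_two hA hc ha hb h01 h23
  · have := (hp.shift (m := n - 2) (l := 5) (by lia)).mul_apply_lt_two hA
    rw [show n - 2 + 2 = n by lia, show n - 2 + 3 = n + 1 by lia] at this
    lia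

lemma hasLargeCommutingSet_of_cover (hA : IsPositiveCartan A) (hp : IsDynkinPath A k p)
    (hc : ∀ v, ∃ i < k, v = p i) : HasLargeCommutingSet A := by
  by_cases hw : ∀ i, i + 1 < k → A (p i) (p (i + 1)) * A (p (i + 1)) (p i) < 2
  · exact hp.hasLargeCommutingSet_of_fin hc (LatticeModel.hasLargeCommutingSet_path k) fun i j ↦
      hp.apply_eq_pathCartan hA hw i.2 j.2
  · push Not at hw
    obtain ⟨n, hn, h⟩ := hw
    exact hp.hasLargeCommutingSet_of_two_le hA hc hn h

lemma mul_lt_two_of_branch (hA : IsPositiveCartan A) (hp : IsDynkinPath A k p) {d : ι} {m i : ℕ}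
    (hm0 : 0 < m) (hm : m + 1 < k) (hd : ∀ i < k, d ≠ p i) (h : A d (p m) ≠ 0) (hi : i + 1 < k) :
    A (p i) (p (i + 1)) * A (p (i + 1)) (p i) < 2 := by
  classical
  by_contra! hw
  wlog hmi : m ≤ i generalizing p m i
  · refine this (hp.reverse hA) (m := k - 1 - m) (i := k - 2 - i) (by lia) (by lia)
      (fun j hj ↦ hd _ (by lia)) ?_ (by lia) ?_ (by lia)
    · rwa [show k - 1 - (k - 1 - m) = m by lia]
    · rwa [show k - 1 - (k - 2 - i) = i + 1 by lia,
        show k - 1 - (k - 2 - i + 1) = i by lia, mul_comm]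
  refine (hp.shift (m := m) (l := i - m + 1) (by lia)).not_capped hA (N := {p (m - 1), d})
    (N' := {p (i + 1)}) (fun v hv t ht ↦ ?_) (fun v hv t ht ↦ ?_) ?_ ?_ ?_
  · rcases mem_insert.mp hv with rfl | hv
    · exact hp.ne (by lia) (by lia) (by lia)
    · rw [mem_singleton.mp hv]
      exact hd _ (by lia)
  · rw [mem_singleton.mp hv]
    exact hp.ne (by lia) (by lia) (by lia)
  · simpa using ⟨hp.ne hi (by lia) (by lia), (hd _ hi).symm⟩
  · rw [sum_pair (hd _ (by lia)).symm]
    have h1 := hp.one_le_mul hA (i := m - 1) (by lia)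
    have h2 := hA.one_le_mul (hd m (by lia)) h
    rw [show m - 1 + 1 = m by lia] at h1
    rw [add_zero]
    linarith
  · rwa [sum_singleton, show m + (i - m) = i by lia]

lemma branch_unique (hA : IsPositiveCartan A) (hp : IsDynkinPath A k p) {d d' : ι} {m m' : ℕ}
    (hm0 : 0 < m) (hm : m + 1 < k) (hm0' : 0 < m') (hm' : m' + 1 < k) (hd : ∀ i < k, d ≠ p i)
    (hd' : ∀ i < k, d' ≠ p i) (h : A d (p m) ≠ 0) (h' : A d' (p m') ≠ 0) : d = d' := by
  classical
  by_contra hdd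
  wlog hmm : m ≤ m' generalizing d d' m m'
  · exact this hm0' hm' hm0 hm hd' hd h' h (Ne.symm hdd) (by lia)
  refine (hp.shift (m := m) (l := m' - m + 1) (by lia)).not_capped hA (N := {p (m - 1), d})
    (N' := {p (m' + 1), d'}) (fun v hv t ht ↦ ?_) (fun v hv t ht ↦ ?_) ?_ ?_ ?_
  · rcases mem_insert.mp hv with rfl | hv
    · exact hp.ne (by lia) (by lia) (by lia)
    · rw [mem_singleton.mp hv]
      exact hd _ (by lia)
  · rcases mem_insert.mp hv with rfl | hv
    · exact hp.ne (by lia) (by lia) (by lia)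
    · rw [mem_singleton.mp hv]
      exact hd' _ (by lia)
  · have h1 := hp.ne (i := m' + 1) (j := m - 1) (by lia) (by lia) (by lia)
    have h2 := hd (m' + 1) (by lia)
    have h3 := hd' (m - 1) (by lia)
    simp only [disjoint_insert_right, disjoint_singleton_right, mem_insert, mem_singleton, not_or]
    exact ⟨⟨h1, h2.symm⟩, h3, Ne.symm hdd⟩
  · rw [sum_pair (hd _ (by lia)).symm]
    have h1 := hp.one_le_mul hA (i := m - 1) (by lia)
    have h2 := hA.one_le_mul (hd m (by lia)) h
    rw [show m - 1 + 1 = m by lia] at h1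
    rw [add_zero]
    linarith
  · rw [sum_pair (hd' _ (by lia)).symm, show m + (m' - m) = m' by lia]
    have h1 := hp.one_le_mul hA (i := m') (by lia)
    have h2 := hA.one_le_mul (hd' m' (by lia)) h'
    linarith

lemma hasLargeCommutingSet_of_branch (hA : IsPositiveCartan A) (hp : IsDynkinPath A k p) {d : ι}
    {m : ℕ} (hm0 : 0 < m) (hm : m + 1 < k) (hd : ∀ i < k, d ≠ p i) (h : A d (p m) ≠ 0)
    (hc : ∀ v, v = d ∨ ∃ i < k, v = p i) : HasLargeCommutingSet A := by
  classical
  wlog hkm : k ≤ 2 * m + 1 generalizing p m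
  · refine this (hp.reverse hA) (m := k - 1 - m) (by lia) (by lia) (fun j hj ↦ hd _ (by lia)) ?_
      (fun v ↦ (hc v).imp_right ?_) (by lia)
    · rwa [show k - 1 - (k - 1 - m) = m by lia]
    · rintro ⟨i, hi, rfl⟩
      exact ⟨k - 1 - i, by lia, by rw [show k - 1 - (k - 1 - i) = i by lia]⟩
  have hdm : A d (p m) * A (p m) d < 2 := by
    have h1 := hp.one_le_mul hA (i := m) hm
    have h2 := hp.one_le_mul hA (i := m - 1) (by lia)
    rw [show m - 1 + 1 = m by lia] at h2
    have h3 := hA.star_lt (s := p m) (N := {p (m - 1), p (m + 1), d}) (by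
      simpa using ⟨hp.ne (by lia) (by lia) (by lia), hp.ne (by lia) hm (by lia),
        (hd m (by lia)).symm⟩)
    have h4 := hp.ne (i := m - 1) (j := m + 1) (by lia) (by lia) (by lia)
    rw [sum_insert (by simpa using ⟨h4, (hd (m - 1) (by lia)).symm⟩),
      sum_pair (hd (m + 1) hm).symm] at h3
    linarith
  obtain ⟨ha, hb⟩ := hA.eq_neg_one (hd m (by lia)) h hdm
  have key := hp.hasLargeCommutingSet_of_ext hA (fun i ↦ hp.mul_lt_two_of_branch hA hm0 hm hd h)
    hd hc
    (fun i hi him ↦ hp.apply_eq_zero_of_adj hA (by lia) hi hd h him) ha hb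
  have hq : IsDynkinPath A 1 fun _ ↦ d := ⟨by lia, by lia⟩
  have htri := hp.tripod_lt hA hq (by lia) one_pos (fun i hi _ _ ↦ hd i hi) h
  obtain ⟨r, rfl⟩ : ∃ r, k = m + r := ⟨k - m, by lia⟩
  push_cast at htri
  rw [add_sub_cancel_left] at htri
  have hr : r < 4 := by
    zify
    by_contra! hr
    have : (r : ℤ) ≤ m + 1 := by lia
    nlinarith
  interval_cases r
  · lia
  · lia
  · exact key (LatticeModel.hasLargeCommutingSet_fork m)
  · obtain h2 | rfl : (m = 2 ∨ m = 3) ∨ m = 4 := by lia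
    · exact key (LatticeModel.hasLargeCommutingSet_exceptional h2)
    · exact key LatticeModel.hasLargeCommutingSet_exceptional_eight

lemma le_card (hp : IsDynkinPath A k p) : k ≤ Fintype.card ι := by
  simpa using Fintype.card_le_of_injective (fun i : Fin k ↦ p i) fun i j h ↦
    Fin.ext (hp.inj i.2 j.2 h)

end IsDynkinPath

lemma IsFiniteCartan.hasLargeCommutingSet {ι : Type*} [Fintype ι] {A : ι → ι → ℤ}
    (hA : IsFiniteCartan A) : HasLargeCommutingSet A := by
  classical
  have hP := hA.toIsPositiveCartan
  rcases isEmpty_or_nonempty ι with _ | ⟨⟨v₀⟩⟩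
  · exact IsDynkinPath.hasLargeCommutingSet_of_equiv (f := fun i : Fin 0 ↦ i.elim0)
      ⟨fun i ↦ i.elim0, isEmptyElim⟩ (LatticeModel.hasLargeCommutingSet_path 0) fun i ↦ i.elim0
  have h1 : ∃ p, IsDynkinPath A 1 p := ⟨fun _ ↦ v₀, by lia, by lia⟩
  obtain ⟨k, hk1, ⟨p, hp⟩, hmax⟩ : ∃ k, 1 ≤ k ∧ (∃ p, IsDynkinPath A k p) ∧
      ∀ l p, IsDynkinPath A l p → l ≤ k := by
    have hcard := h1.choose_spec.le_card
    refine ⟨Nat.findGreatest (fun k ↦ ∃ p, IsDynkinPath A k p) (Fintype.card ι),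
      Nat.le_findGreatest hcard h1,
      Nat.findGreatest_spec (P := fun k ↦ ∃ p, IsDynkinPath A k p) hcard h1,
      fun l p hp ↦ Nat.le_findGreatest hp.le_card ⟨p, hp⟩⟩
  by_cases hd : ∃ d m, m < k ∧ (∀ i < k, d ≠ p i) ∧ A d (p m) ≠ 0
  swap
  · push Not at hd
    refine hp.hasLargeCommutingSet_of_cover hP fun v ↦
      hA.connected (T := {v | ∃ i < k, v = p i}) (i := p 0) ⟨0, hk1, rfl⟩ ?_ v
    rintro _ ⟨i, hi, rfl⟩ j hj
    by_contra h0
    exact hP.ne_zero_symm hj (hd j i hi fun t ht h ↦ h0 ⟨t, ht, h⟩)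
  have interior {d : ι} {m : ℕ} (hm : m < k) (hd : ∀ i < k, d ≠ p i) (h : A d (p m) ≠ 0) :
      0 < m ∧ m + 1 < k := by
    constructor
    · by_contra hm0
      obtain rfl : m = 0 := by lia
      exact absurd (hmax _ _ (hp.cons hd fun _ ↦ h)) (by lia)
    · by_contra hm0
      obtain rfl : m = k - 1 := by lia
      exact absurd (hmax _ _ ((hp.reverse hP).cons (fun i hi ↦ hd _ (by lia)) fun _ ↦ h)) (by lia)
  obtain ⟨d, m, hm, hd, h⟩ := hd
  obtain ⟨hm0, hm1⟩ := interior hm hd h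
  refine hp.hasLargeCommutingSet_of_branch hP hm0 hm1 hd h fun v ↦
    hA.connected (T := {v | v = d ∨ ∃ i < k, v = p i}) (i := d) (.inl rfl) ?_ v
  rintro w (hw | ⟨i, hi, rfl⟩) e he <;> by_contra h0
  · rw [hw] at he
    obtain ⟨h0, h0'⟩ := not_or.mp h0
    have hep : ∀ i < k, e ≠ p i := fun i hi h ↦ h0' ⟨i, hi, h⟩
    have he' := hP.ne_zero_symm he
    have hlong {r : ℕ} {q : ℕ → ι} (hq : IsDynkinPath A r q) (hqp : ∀ t < r, ∃ i < k, q t = p i)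
        (h : A d (q 0) ≠ 0) : r + 2 ≤ k := by
      refine hmax _ _ ((hq.cons (fun i hi ↦ ?_) fun _ ↦ h).cons (d := e) (fun i hi ↦ ?_)
        fun _ ↦ he')
      · obtain ⟨j, hj, hij⟩ := hqp i hi
        exact fun h ↦ hd j hj (h.trans hij)
      · cases i with
        | zero => exact h0
        | succ i =>
          obtain ⟨j, hj, hij⟩ := hqp i (by lia)
          exact fun h ↦ hep j hj (h.trans hij)
    have h2 := hlong (hp.shift (m := m) (l := k - m) (by lia)) (fun t ht ↦ ⟨_, by lia, rfl⟩) h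
    have h3 := hlong ((hp.reverse hP).shift (m := k - 1 - m) (l := m + 1) (by lia))
      (fun t ht ↦ ⟨_, by lia, rfl⟩) (by rwa [add_zero, show k - 1 - (k - 1 - m) = m by lia])
    have hq : IsDynkinPath A 1 fun _ ↦ e := ⟨by lia, by lia⟩
    have h4 := hp.tripod_lt hP (hq.cons (fun _ _ ↦ Ne.symm h0) fun _ ↦ he) hm two_pos
      (fun i hi t ht ↦ by cases t; exacts [hd i hi, hep i hi]) h
    have h5 : (2 : ℤ) ≤ m := by lia
    have h6 : (3 : ℤ) ≤ k - m := by lia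
    push_cast at h4
    nlinarith
  · have hed : ∀ i < k, e ≠ p i := fun j hj h ↦ h0 (.inr ⟨j, hj, h⟩)
    have he' := hP.ne_zero_symm he
    obtain ⟨hi0, hi1⟩ := interior hi hed he'
    exact h0 (.inl (hp.branch_unique hP hm0 hm1 hi0 hi1 hd hed h he').symm)

namespace LieAlgebra

variable {L : Type*} [LieRing L] [LieAlgebra ℂ L] [FiniteDimensional ℂ L]

lemma IsSimple.exists_commuting_submodule [IsSimple ℂ L] :
    ∃ W : Submodule ℂ L, (∀ x ∈ W, ∀ y ∈ W, ⁅x, y⁆ = 0) ∧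
      Module.finrank ℂ L ≤ 7 * Module.finrank ℂ W := by
  obtain ⟨x, hx⟩ := exists_isCartanSubalgebra_engel ℂ L
  obtain ⟨b⟩ := (IsKilling.rootSystem (LieSubalgebra.engel ℂ x)).nonempty_base
  exact IsKilling.exists_commuting_submodule _ b
    b.isFiniteCartan_cartanMatrix.hasLargeCommutingSet

lemma IsSemisimple.exists_commuting_submodule_of_isAtom [IsSemisimple ℂ L]
    (s : Finset (LieIdeal ℂ L)) (hs : ∀ I ∈ s, IsAtom I) :
    ∃ W : Submodule ℂ L, W ≤ (s.sup id).toSubmodule ∧ (∀ x ∈ W, ∀ y ∈ W, ⁅x, y⁆ = 0) ∧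
      Module.finrank ℂ (s.sup id : LieIdeal ℂ L) ≤ 7 * Module.finrank ℂ W := by
  classical
  induction s using Finset.induction_on with
  | empty => exact ⟨⊥, by simp, by simp, (finrank_bot ℂ L).trans_le (Nat.zero_le _)⟩
  | insert I s hI ih =>
    obtain ⟨W, hWs, hW, hdW⟩ := ih fun J hJ ↦ hs J (Finset.mem_insert_of_mem hJ)
    have hIat := hs I (Finset.mem_insert_self I s)
    have : IsSimple ℂ I := isSimple_of_isAtom I hIat
    obtain ⟨V, hV, hdV⟩ := IsSimple.exists_commuting_submodule (L := I)
    have hdisj : Disjoint I (s.sup id) := by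
      have := (sSupIndep_isAtom (R := ℂ) (L := L)) hIat
      refine this.mono_right ?_
      refine Finset.sup_le fun J hJ ↦ le_sSup ⟨hs J (Finset.mem_insert_of_mem hJ), ?_⟩
      rintro rfl
      exact hI hJ
    have hdisj' : Disjoint I.toSubmodule (s.sup id).toSubmodule :=
      LieSubmodule.disjoint_toSubmodule.mpr hdisj
    set V' := V.map I.toSubmodule.subtype with hV'
    have hVI : V' ≤ I.toSubmodule := Submodule.map_subtype_le _ _
    have hdV' : Module.finrank ℂ V' = Module.finrank ℂ V :=
      Submodule.finrank_map_subtype_eq _ _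
    have hVW {x y : L} (hx : x ∈ V') (hy : y ∈ W) : ⁅x, y⁆ = 0 := by
      have h1 : ⁅x, y⁆ ∈ I := lie_mem_left ℂ L I x y (hVI hx)
      have h2 : ⁅x, y⁆ ∈ s.sup id := lie_mem_right ℂ L _ x y (hWs hy)
      exact (Submodule.disjoint_def.mp hdisj') _ h1 h2
    have hVV {x y : L} (hx : x ∈ V') (hy : y ∈ V') : ⁅x, y⁆ = 0 := by
      obtain ⟨x, hx, rfl⟩ := hx
      obtain ⟨y, hy, rfl⟩ := hy
      exact congr_arg Subtype.val (hV x hx y hy)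
    refine ⟨V' ⊔ W, ?_, ?_, ?_⟩
    · rw [Finset.sup_insert, LieSubmodule.sup_toSubmodule]
      exact sup_le_sup hVI hWs
    · intro x hx y hy
      obtain ⟨x1, hx1, x2, hx2, rfl⟩ := Submodule.mem_sup.mp hx
      obtain ⟨y1, hy1, y2, hy2, rfl⟩ := Submodule.mem_sup.mp hy
      rw [add_lie, lie_add, lie_add, hVV hx1 hy1, hVW hx1 hy2, hW _ hx2 _ hy2, ← lie_skew,
        hVW hy1 hx2]
      simp
    · have h1 : Module.finrank ℂ (V' ⊔ W : Submodule ℂ L) =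
          Module.finrank ℂ V + Module.finrank ℂ W := by
        have := Submodule.finrank_sup_add_finrank_inf_eq V' W
        rw [(hdisj'.mono hVI hWs).eq_bot, finrank_bot, add_zero] at this
        rw [this, hdV']
      have h2 := Submodule.finrank_add_le_finrank_add_finrank I.toSubmodule (s.sup id).toSubmodule
      rw [← LieSubmodule.sup_toSubmodule] at h2
      rw [Finset.sup_insert, h1]
      simp only [id_eq]
      change Module.finrank ℂ (I ⊔ s.sup id : LieIdeal ℂ L).toSubmodule ≤ _
      refine h2.trans ?_
      change Module.finrank ℂ I + Module.finrank ℂ (s.sup id : LieIdeal ℂ L) ≤ _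
      lia

lemma IsSemisimple.exists_commuting_submodule [IsSemisimple ℂ L] :
    ∃ W : Submodule ℂ L, (∀ x ∈ W, ∀ y ∈ W, ⁅x, y⁆ = 0) ∧
      Module.finrank ℂ L ≤ 7 * Module.finrank ℂ W := by
  have hfin : {I : LieIdeal ℂ L | IsAtom I}.Finite :=
    WellFoundedGT.finite_of_sSupIndep sSupIndep_isAtom
  obtain ⟨W, -, hW, hd⟩ := exists_commuting_submodule_of_isAtom hfin.toFinset (L := L) (by simp)
  refine ⟨W, hW, ?_⟩
  rw [Finset.sup_id_eq_sSup, hfin.coe_toFinset, sSup_atoms_eq_top] at hd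
  rwa [← finrank_top (R := ℂ) (M := L)]

end LieAlgebra

/-- If `𝔤` is a finite-dimensional semisimple complex Lie algebra in which every abelian Lie
subalgebra has dimension at most `n`, then `dim 𝔤 ≤ 7n`. -/
theorem dim_le_of_semisimple_complex_lie_algebra
    (L : Type*) [LieRing L] [LieAlgebra ℂ L]
    [FiniteDimensional ℂ L] [LieAlgebra.IsSemisimple ℂ L] (n : ℕ)
    (hA : ∀ H : LieSubalgebra ℂ L, IsLieAbelian H → Module.finrank ℂ H ≤ n) :
    Module.finrank ℂ L ≤ 7 * n := by
  obtain ⟨W, hW, hd⟩ := LieAlgebra.IsSemisimple.exists_commuting_submodule (L := L)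
  let H : LieSubalgebra ℂ L :=
    { W with lie_mem' := fun {x y} hx hy ↦ by rw [hW x hx y hy]; exact W.zero_mem }
  have hH : IsLieAbelian H := ⟨fun x y ↦ Subtype.ext (hW x x.2 y y.2)⟩
  exact hd.trans (Nat.mul_le_mul_left 7 (hA H hH))
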